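/- arXiv:2102.10723 — 5 statements merged into one kernel-verified Lean document; each statement's English description precedes it below -/
import Mathlib

section
/- Let p be a prime, F a finite extension of ℚ_p with ring of integers 𝒪 and normalized additive valuation ord (so ord of a uniformizer is 1). Then the minimum M of ord(a²−1) over all units a ∈ 𝒪^× is: M = 0 if the residue field has cardinality q ≥ 4; M = 1 if q = 3; M = 2 if q = 2 and F ≠ ℚ₂ (i.e. [F:ℚ₂] > 1); and M = 3 if F = ℚ₂. -/
open Polynomial in
/-- Every `u ≡ 1 mod p` in `ℤ_p` is a `(p + 1)`-st power of some `w ≡ 1 mod p`. -/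
theorem PadicInt.exists_pow_succ_eq {p : ℕ} [Fact p.Prime] (u : ℤ_[p]) (hu : (p : ℤ_[p]) ∣ u - 1) :
    ∃ w : ℤ_[p], (p : ℤ_[p]) ∣ w - 1 ∧ w ^ (p + 1) = u := by
  have hp : ‖((p : ℤ_[p]) + 1)‖ = 1 := by
    rw [PadicInt.norm_add_eq_max_of_ne] <;> rw [norm_one]
    · exact max_eq_right (PadicInt.norm_le_one _)
    · exact (PadicInt.norm_lt_one_iff_dvd _).2 dvd_rfl |>.ne
  have hd : ‖(derivative (X ^ (p + 1) - C u)).aeval (1 : ℤ_[p])‖ = 1 := by simpa using hp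
  obtain ⟨w, hw, hw1, -⟩ := hensels_lemma (p := p) (F := X ^ (p + 1) - C u) (a := (1 : ℤ_[p])) (by
    rw [hd]
    have : ‖1 - u‖ < 1 := by
      rw [norm_sub_rev]; exact (PadicInt.norm_lt_one_iff_dvd _).2 hu
    simpa using this)
  refine ⟨w, (PadicInt.norm_lt_one_iff_dvd _).1 (hd ▸ hw1), ?_⟩
  simpa [sub_eq_zero] using hw

/-- `ord` behaves as an additive valuation on the nonzero elements of `F`. -/
structure IsAddOrd {F : Type*} [Field F] (ord : F → ℤ) : Prop where
  mul : ∀ x y : F, x ≠ 0 → y ≠ 0 → ord (x * y) = ord x + ord y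
  add : ∀ x y : F, x ≠ 0 → y ≠ 0 → x + y ≠ 0 → min (ord x) (ord y) ≤ ord (x + y)

/-- The valuation of `x` is at least `n`, where `0` has infinite valuation. -/
def OrdGE {F : Type*} [Field F] (ord : F → ℤ) (n : ℤ) (x : F) : Prop := x = 0 ∨ n ≤ ord x

namespace IsAddOrd

variable {F : Type*} [Field F] {ord : F → ℤ}

theorem one (h : IsAddOrd ord) : ord 1 = 0 := by
  have := h.mul 1 1 one_ne_zero one_ne_zero
  rw [mul_one] at this
  lia

theorem pow (h : IsAddOrd ord) {x : F} (hx : x ≠ 0) (n : ℕ) : ord (x ^ n) = n * ord x := by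
  induction n with
  | zero => simp [h.one]
  | succ n ih => rw [pow_succ, h.mul _ _ (pow_ne_zero n hx) hx, ih]; push_cast; ring

theorem neg_one (h : IsAddOrd ord) : ord (-1) = 0 := by
  have := h.pow (x := -1) (by simp) 2
  rw [neg_one_sq, h.one] at this
  lia

theorem neg (h : IsAddOrd ord) {x : F} (hx : x ≠ 0) : ord (-x) = ord x := by
  rw [← neg_one_mul, h.mul _ _ (by simp) hx, h.neg_one, zero_add]

theorem inv (h : IsAddOrd ord) {x : F} (hx : x ≠ 0) : ord x⁻¹ = -ord x := by
  have := h.mul x x⁻¹ hx (inv_ne_zero hx)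
  rw [mul_inv_cancel₀ hx, h.one] at this
  lia

theorem ordGE_add (h : IsAddOrd ord) {n : ℤ} {x y : F} (hx : OrdGE ord n x) (hy : OrdGE ord n y) :
    OrdGE ord n (x + y) := by
  rcases eq_or_ne x 0 with rfl | hx0
  · rwa [zero_add]
  rcases eq_or_ne y 0 with rfl | hy0
  · rwa [add_zero]
  rcases eq_or_ne (x + y) 0 with hs | hs
  · exact .inl hs
  · exact .inr ((le_min (hx.resolve_left hx0) (hy.resolve_left hy0)).trans (h.add x y hx0 hy0 hs))

theorem ordGE_neg (h : IsAddOrd ord) {n : ℤ} {x : F} (hx : OrdGE ord n x) : OrdGE ord n (-x) := by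
  rcases eq_or_ne x 0 with rfl | hx0
  · rwa [neg_zero]
  · exact .inr (by rw [h.neg hx0]; exact hx.resolve_left hx0)

theorem ordGE_sub (h : IsAddOrd ord) {n : ℤ} {x y : F} (hx : OrdGE ord n x) (hy : OrdGE ord n y) :
    OrdGE ord n (x - y) :=
  sub_eq_add_neg x y ▸ h.ordGE_add hx (h.ordGE_neg hy)

theorem ordGE_mul (h : IsAddOrd ord) {k n : ℤ} {x y : F} (hx : OrdGE ord k x)
    (hy : OrdGE ord n y) : OrdGE ord (k + n) (x * y) := by
  rcases eq_or_ne x 0 with rfl | hx0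
  · exact .inl (zero_mul _)
  rcases eq_or_ne y 0 with rfl | hy0
  · exact .inl (mul_zero _)
  · have := hx.resolve_left hx0
    have := hy.resolve_left hy0
    exact .inr (by rw [h.mul x y hx0 hy0]; lia)

theorem ordGE_natCast (h : IsAddOrd ord) (n : ℕ) : OrdGE ord 0 (n : F) := by
  induction n with
  | zero => exact .inl (by simp)
  | succ n ih => push_cast; exact h.ordGE_add ih (.inr h.one.ge)

theorem eq_zero_of_forall_ordGE {x : F} (hx : ∀ n : ℕ, OrdGE ord n x) : x = 0 := by
  by_contra hx0
  have := (hx ((ord x).toNat + 1)).resolve_left hx0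
  lia

section PadicInt

variable {p : ℕ} [Fact p.Prime] {f : ℤ_[p] →+* F}

theorem padicInt_of_dvd_sub_one (h : IsAddOrd ord) (hf : Function.Injective f) (u : ℤ_[p])
    (hu : (p : ℤ_[p]) ∣ u - 1) : ord (f u) = 0 := by
  have key (k : ℕ) : ∀ u : ℤ_[p], (p : ℤ_[p]) ∣ u - 1 → ((p + 1 : ℕ) : ℤ) ^ k ∣ ord (f u) := by
    induction k with
    | zero => simp
    | succ k ih =>
      intro u hu
      obtain ⟨w, hw, rfl⟩ := u.exists_pow_succ_eq hu
      have hw0 : w ≠ 0 := by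
        rintro rfl
        refine (PadicInt.prime_p (p := p)).not_isUnit (isUnit_of_dvd_one ?_)
        simpa using hw
      rw [map_pow, h.pow ((map_ne_zero_iff f hf).2 hw0), pow_succ']
      exact mul_dvd_mul_left _ (ih w hw)
  by_contra h0
  have hp : 1 < p + 1 := by have := (Fact.out : p.Prime).pos; lia
  obtain ⟨k, hk⟩ : ∃ k : ℕ, (ord (f u)).natAbs < (p + 1) ^ k := ⟨_, Nat.lt_pow_self hp⟩
  refine absurd (Int.natAbs_dvd_natAbs.2 (key k u hu)) fun hd => ?_
  rw [Int.natAbs_pow, Int.natAbs_natCast] at hd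
  exact (Nat.le_of_dvd (Int.natAbs_pos.2 h0) hd).not_gt hk

theorem padicInt_unit (h : IsAddOrd ord) (hf : Function.Injective f) {u : ℤ_[p]}
    (hu : IsUnit u) : ord (f u) = 0 := by
  have h1 : (p : ℤ_[p]) ∣ u ^ (p - 1) - 1 := by
    rw [← Ideal.mem_span_singleton, ← PadicInt.maximalIdeal_eq_span_p, ← PadicInt.ker_toZMod,
      RingHom.mem_ker, map_sub, map_pow, map_one, sub_eq_zero]
    exact ZMod.pow_card_sub_one_eq_one (hu.map PadicInt.toZMod).ne_zero
  have h2 := h.padicInt_of_dvd_sub_one hf _ h1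
  rw [map_pow, h.pow ((map_ne_zero_iff f hf).2 hu.ne_zero)] at h2
  have := (Fact.out : p.Prime).two_le
  exact (mul_eq_zero.1 h2).resolve_left (by lia)

theorem padicInt_eq (h : IsAddOrd ord) (hf : Function.Injective f) {z : ℤ_[p]} (hz : z ≠ 0) :
    ord (f z) = z.valuation * ord (p : F) := by
  have hp : (p : F) ≠ 0 := by
    rw [← map_natCast f]
    exact (map_ne_zero_iff f hf).2 PadicInt.prime_p.ne_zero
  conv_lhs => rw [PadicInt.unitCoeff_spec hz]
  rw [map_mul, map_pow, map_natCast, h.mul _ _ _ (pow_ne_zero _ hp), h.pow hp,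
    h.padicInt_unit hf (Units.isUnit _), zero_add]
  exact (map_ne_zero_iff f hf).2 (Units.ne_zero _)

theorem ordGE_padicInt (h : IsAddOrd ord) (hf : Function.Injective f) (z : ℤ_[p]) :
    OrdGE ord 0 (f z) := by
  rcases eq_or_ne z 0 with rfl | hz
  · exact .inl (map_zero f)
  have hp : (p : F) ≠ 0 := by
    rw [← map_natCast f]
    exact (map_ne_zero_iff f hf).2 PadicInt.prime_p.ne_zero
  refine .inr ?_
  rw [h.padicInt_eq hf hz]
  exact mul_nonneg (by positivity) ((h.ordGE_natCast p).resolve_left hp)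

theorem ordGE_padicInt_iff (h : IsAddOrd ord) (hf : Function.Injective f)
    (hp : ord (p : F) = 1) (z : ℤ_[p]) (n : ℕ) : OrdGE ord n (f z) ↔ (p : ℤ_[p]) ^ n ∣ z := by
  rcases eq_or_ne z 0 with rfl | hz
  · simp [OrdGE]
  rw [OrdGE, map_eq_zero_iff f hf, or_iff_right hz, h.padicInt_eq hf hz, hp, mul_one, Nat.cast_le,
    ← PadicInt.mem_span_pow_iff_le_valuation z hz, Ideal.mem_span_singleton]

/-- If `p` is a uniformizer and every integral element is congruent to a natural number, then
every integral element lies in `ℤ_p`. -/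
theorem exists_padicInt_eq (h : IsAddOrd ord) (hf : Function.Injective f)
    (hp : ord (p : F) = 1) (hres : ∀ x : F, OrdGE ord 0 x → ∃ d : ℕ, OrdGE ord 1 (x - d))
    {x : F} (hx : OrdGE ord 0 x) : ∃ z : ℤ_[p], f z = x := by
  have hp0 : (p : F) ≠ 0 := by
    rw [← map_natCast f]
    exact (map_ne_zero_iff f hf).2 PadicInt.prime_p.ne_zero
  have approx (n : ℕ) : ∀ x : F, OrdGE ord 0 x → ∃ z : ℕ, OrdGE ord n (x - z) := by
    induction n with
    | zero => exact fun x hx => ⟨0, by simpa using hx⟩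
    | succ n ih =>
      intro x hx
      obtain ⟨d, hd⟩ := hres x hx
      have hd' := h.ordGE_mul (k := -1) (x := (p : F)⁻¹) (.inr (by rw [h.inv hp0, hp])) hd
      obtain ⟨z, hz⟩ := ih _ hd'
      refine ⟨d + p * z, ?_⟩
      have := h.ordGE_mul (k := 1) (x := (p : F)) (.inr hp.ge) hz
      rw [mul_sub, mul_inv_cancel_left₀ hp0] at this
      push_cast
      rwa [← sub_sub, add_comm]
  choose z hz using fun n => approx n x hx
  have mono {a b : ℕ} (hab : a ≤ b) {y : F} (hy : OrdGE ord b y) : OrdGE ord a y :=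
    hy.imp_right fun hy => by lia
  have smodEq_iff (n : ℕ) (a b : ℤ_[p]) :
      a ≡ b [SMOD (IsLocalRing.maximalIdeal ℤ_[p] ^ n • ⊤ : Submodule ℤ_[p] ℤ_[p])] ↔
        OrdGE ord n (f a - f b) := by
    rw [smul_eq_mul, Ideal.mul_top, SModEq.sub_mem, PadicInt.maximalIdeal_eq_span_p,
      Ideal.span_singleton_pow, Ideal.mem_span_singleton, ← h.ordGE_padicInt_iff hf hp, map_sub]
  obtain ⟨L, hL⟩ := IsPrecomplete.prec (I := IsLocalRing.maximalIdeal ℤ_[p]) (M := ℤ_[p])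
    inferInstance (f := fun n => (z n : ℤ_[p])) (fun {a b} hab => by
      rw [smodEq_iff, map_natCast, map_natCast]
      simpa using h.ordGE_sub (mono hab (hz b)) (hz a))
  refine ⟨L, (sub_eq_zero.1 (eq_zero_of_forall_ordGE (ord := ord) fun n => ?_)).symm⟩
  have := (smodEq_iff n _ _).1 (hL n)
  rw [map_natCast] at this
  simpa using h.ordGE_add (hz n) this

end PadicInt

end IsAddOrd

theorem ZMod.eight_sq_eq_one_of_mul_eq_one : ∀ x y : ZMod (2 ^ 3), x * y = 1 → x ^ 2 = 1 := by
  decide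

theorem PadicInt.eight_dvd_sq_sub_one {z : ℤ_[2]} (hz : IsUnit z) : (2 : ℤ_[2]) ^ 3 ∣ z ^ 2 - 1 := by
  obtain ⟨w, hw⟩ := hz.exists_right_inv
  have : z ^ 2 - 1 ∈ RingHom.ker (PadicInt.toZModPow (p := 2) 3) := by
    rw [RingHom.mem_ker, map_sub, map_pow, map_one, sub_eq_zero]
    exact ZMod.eight_sq_eq_one_of_mul_eq_one _ (PadicInt.toZModPow 3 w) (by
      rw [← map_mul, hw, map_one])
  rw [PadicInt.ker_toZModPow, Ideal.mem_span_singleton] at this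
  exact_mod_cast this

theorem Padic.exists_padicInt_eq_or_inv_eq {p : ℕ} [Fact p.Prime] (y : ℚ_[p]) :
    ∃ z : ℤ_[p], y = z ∨ y = (z : ℚ_[p])⁻¹ := by
  rcases le_total ‖y‖ 1 with hy | hy
  · exact ⟨⟨y, hy⟩, .inl rfl⟩
  · exact ⟨⟨y⁻¹, by rw [norm_inv]; exact inv_le_one_of_one_le₀ hy⟩, .inr (inv_inv y).symm⟩


/-- Let `p` be a prime and `F` a finite extension of `ℚ_p`.
`O` is the ring of integers (the valuation ring) of `F`, `m` its maximal ideal,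
`q` the cardinality of the residue field `O/m`, and `ord` the normalized additive
valuation on `F` (so `ord π = 1` for a uniformizer `π`).  Then the minimum `M` of
`ord (a^2 - 1)` over units `a` of `O` (with `a^2 ≠ 1`) satisfies:
`M = 0` if `q ≥ 4`; `M = 1` if `q = 3`; `M = 2` if `q = 2` and `F ≠ ℚ₂`;
`M = 3` if `F = ℚ₂`. -/
theorem stmt0 (p : ℕ) [Fact p.Prime] (F : Type*) [Field F]
    [Algebra ℚ_[p] F] [FiniteDimensional ℚ_[p] F]
    (ord : F → ℤ)
    (hord_mul : ∀ x y : F, x ≠ 0 → y ≠ 0 → ord (x * y) = ord x + ord y)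
    (hord_add : ∀ x y : F, x ≠ 0 → y ≠ 0 → x + y ≠ 0 →
      min (ord x) (ord y) ≤ ord (x + y))
    (hord_unif : ∃ π : F, π ≠ 0 ∧ ord π = 1)
    (O : Subring F)
    (hO : ∀ x : F, x ∈ O ↔ x = 0 ∨ 0 ≤ ord x)
    (m : Ideal O)
    (hm : ∀ x : O, x ∈ m ↔ 1 ≤ ord (x : F))
    (q : ℕ) (hq : q = Nat.card (O ⧸ m)) :
    (4 ≤ q → IsLeast {n : ℤ | ∃ a : Oˣ, ((a : O) : F) ^ 2 - 1 ≠ 0 ∧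
      ord (((a : O) : F) ^ 2 - 1) = n} 0) ∧
    (q = 3 → IsLeast {n : ℤ | ∃ a : Oˣ, ((a : O) : F) ^ 2 - 1 ≠ 0 ∧
      ord (((a : O) : F) ^ 2 - 1) = n} 1) ∧
    (q = 2 ∧ 1 < Module.finrank ℚ_[p] F → IsLeast {n : ℤ | ∃ a : Oˣ,
      ((a : O) : F) ^ 2 - 1 ≠ 0 ∧ ord (((a : O) : F) ^ 2 - 1) = n} 2) ∧
    (p = 2 ∧ Module.finrank ℚ_[p] F = 1 → IsLeast {n : ℤ | ∃ a : Oˣ,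
      ((a : O) : F) ^ 2 - 1 ≠ 0 ∧ ord (((a : O) : F) ^ 2 - 1) = n} 3) := by
  classical
  have h : IsAddOrd ord := ⟨hord_mul, hord_add⟩
  have hO' (x : F) : x ∈ O ↔ OrdGE ord 0 x := hO x
  have hm' (x : O) : x ∈ m ↔ OrdGE ord 1 (x : F) := by
    rw [hm, OrdGE]
    refine ⟨.inr, ?_⟩
    rintro (hx | hx)
    · rw [hx]
      exact (hm 0).1 m.zero_mem
    · exact hx
  have hord0 (x : O) (hx : x ∉ m) : (x : F) ≠ 0 ∧ ord (x : F) = 0 := by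
    rw [hm', OrdGE, not_or] at hx
    have := ((hO' x).1 x.2).resolve_left hx.1
    exact ⟨hx.1, by lia⟩
  have hunit (x : O) (hx : x ∉ m) : ∃ a : Oˣ, (a : O) = x := by
    obtain ⟨hx0, hx1⟩ := hord0 x hx
    have hinv : (x : F)⁻¹ ∈ O := (hO' _).2 (.inr (by rw [h.inv hx0, hx1, neg_zero]))
    exact ⟨Units.mkOfMulEqOne x ⟨_, hinv⟩ (Subtype.ext (mul_inv_cancel₀ hx0)), rfl⟩
  have hmax : m.IsMaximal := by
    refine Ideal.isMaximal_iff.2 ⟨?_, fun J x _ hx hxJ => ?_⟩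
    · rw [hm, O.coe_one, h.one]
      lia
    · obtain ⟨a, rfl⟩ := hunit x hx
      rw [← a.mul_inv]
      exact J.mul_mem_right _ hxJ
  have hnot (a : Oˣ) : (a : O) ∉ m := fun ha => hmax.ne_top (Ideal.eq_top_of_isUnit_mem _ ha a.isUnit)
  let k := O ⧸ m
  let : Field k := Ideal.Quotient.field m
  have hmk (x : O) : Ideal.Quotient.mk m x = 0 ↔ x ∈ m := Ideal.Quotient.eq_zero_iff_mem
  let f : ℤ_[p] →+* F := (algebraMap ℚ_[p] F).comp PadicInt.Coe.ringHom
  have hf : Function.Injective f := (algebraMap ℚ_[p] F).injective.comp Subtype.val_injective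
  have hpF : (p : F) ≠ 0 := by
    rw [← map_natCast f]
    exact (map_ne_zero_iff f hf).2 PadicInt.prime_p.ne_zero
  obtain ⟨π, hπ0, hπ1⟩ := hord_unif
  have hπO : π ∈ O := (hO' π).2 (.inr (by lia))
  have hπm : (⟨π, hπO⟩ : O) ∈ m := (hm' _).2 (.inr hπ1.ge)
  have hsum : ((⟨π, hπO⟩ : O) + 1) ∉ m := fun hc =>
    hmax.ne_top ((Ideal.eq_top_iff_one m).2 ((m.add_mem_iff_right hπm).1 hc))
  have heq : (((⟨π, hπO⟩ : O) + 1 : O) : F) ^ 2 - 1 = π * (π + 2) := by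
    push_cast
    ring
  refine ⟨fun hq4 => ?_, fun hq3 => ?_, ?_, ?_⟩
  · have : Finite k := Nat.finite_of_card_ne_zero (by change Nat.card (O ⧸ m) ≠ 0; lia)
    let := Fintype.ofFinite k
    obtain ⟨x, hx⟩ : ∃ x : k, x ∉ ({0, 1, -1} : Finset k) := by
      by_contra! hc
      have h1 : Fintype.card k ≤ Finset.card ({0, 1, -1} : Finset k) :=
        Finset.card_le_card fun x _ => hc x
      have h2 := h1.trans Finset.card_le_three
      rw [← Nat.card_eq_fintype_card] at h2
      change Nat.card (O ⧸ m) ≤ 3 at h2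
      lia
    obtain ⟨y, rfl⟩ := Ideal.Quotient.mk_surjective x
    simp only [Finset.mem_insert, Finset.mem_singleton, not_or] at hx
    obtain ⟨a, rfl⟩ := hunit y (fun hy => hx.1 ((hmk y).2 hy))
    refine ⟨⟨a, hord0 ((a : O) ^ 2 - 1) fun hc => ?_⟩, ?_⟩
    · rw [← hmk, map_sub, map_pow, map_one, sub_eq_zero, sq_eq_one_iff] at hc
      tauto
    · rintro n ⟨a, ha, rfl⟩
      exact ((hO' _).1 ((a : O) ^ 2 - 1).2).resolve_left ha
  · have : Finite k := Nat.finite_of_card_ne_zero (by change Nat.card (O ⧸ m) ≠ 0; lia)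
    let := Fintype.ofFinite k
    have hcard : Fintype.card k = 3 := by
      rw [← Nat.card_eq_fintype_card]
      exact hq.symm.trans hq3
    refine ⟨?_, ?_⟩
    · obtain ⟨a, ha⟩ := hunit _ hsum
      have h2 : ((⟨π, hπO⟩ : O) + 2) ∉ m := by
        intro hc
        have h2 : (2 : O) ∈ m := (m.add_mem_iff_right hπm).1 hc
        have h3 : ((3 : ℕ) : O) ∈ m := by
          rw [← hmk, map_natCast, ← hcard]
          exact Nat.cast_card_eq_zero k
        refine hmax.ne_top ((Ideal.eq_top_iff_one m).2 ?_)
        have := m.sub_mem h3 h2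
        norm_num at this
        exact this
      obtain ⟨h0, h1⟩ : π + 2 ≠ 0 ∧ ord (π + 2) = 0 := hord0 _ h2
      refine ⟨a, ?_⟩
      rw [ha, heq]
      exact ⟨mul_ne_zero hπ0 h0, by rw [h.mul _ _ hπ0 h0, hπ1, h1, add_zero]⟩
    · rintro n ⟨a, ha, rfl⟩
      refine (hm ((a : O) ^ 2 - 1)).1 ((hmk _).1 ?_)
      have := FiniteField.pow_card_sub_one_eq_one (Ideal.Quotient.mk m a : k)
        (fun hc => hnot a ((hmk _).1 hc))
      rw [hcard] at this
      rw [map_sub, map_pow, map_one, sub_eq_zero]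
      exact this
  · rintro ⟨hq2, hdim⟩
    have : Finite k := Nat.finite_of_card_ne_zero (by change Nat.card (O ⧸ m) ≠ 0; lia)
    let := Fintype.ofFinite k
    have hcard : Fintype.card k = 2 := by
      rw [← Nat.card_eq_fintype_card]
      exact hq.symm.trans hq2
    have h2m : (2 : O) ∈ m := by
      rw [← Nat.cast_ofNat, ← hmk, map_natCast, ← hcard]
      exact Nat.cast_card_eq_zero k
    have h2F : 1 ≤ ord (2 : F) := (hm 2).1 h2m
    have hsub (x : O) (hx : x ∉ m) : x - 1 ∈ m := by
      have := FiniteField.pow_card_sub_one_eq_one (Ideal.Quotient.mk m x : k)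
        (fun hc => hx ((hmk _).1 hc))
      rw [hcard, Nat.add_one_sub_one, pow_one] at this
      rw [← hmk, map_sub, map_one, sub_eq_zero]
      exact this
    have hp2 : p = 2 := by
      by_contra hp
      have hu : IsUnit ((2 : ℕ) : ℤ_[p]) := by
        rw [PadicInt.isUnit_iff, PadicInt.norm_natCast_eq_one_iff]
        exact (Nat.coprime_primes Fact.out Nat.prime_two).2 hp
      have := h.padicInt_unit hf hu
      rw [map_natCast, Nat.cast_ofNat] at this
      lia
    subst hp2
    have h21 : 2 ≤ ord (2 : F) := by
      by_contra! hlt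
      have h21 : ord ((2 : ℕ) : F) = 1 := by
        rw [Nat.cast_ofNat]
        lia
      refine hdim.ne' (Algebra.finrank_eq_one_iff_bijective_algebraMap.2
        ⟨(algebraMap ℚ_[2] F).injective, ?_⟩)
      have key := fun x (hx : OrdGE ord 0 x) => h.exists_padicInt_eq hf h21 (fun x hx => by
        by_cases hxm : (⟨x, (hO' x).2 hx⟩ : O) ∈ m
        · exact ⟨0, by simpa using (hm' _).1 hxm⟩
        · exact ⟨1, by simpa using (hm' _).1 (hsub _ hxm)⟩) hx
      intro x
      rcases eq_or_ne x 0 with rfl | hx0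
      · exact ⟨0, map_zero _⟩
      rcases le_total 0 (ord x) with hx | hx
      · obtain ⟨z, rfl⟩ := key x (.inr hx)
        exact ⟨z, rfl⟩
      · obtain ⟨z, hz⟩ := key x⁻¹ (.inr (by rw [h.inv hx0]; lia))
        exact ⟨(z : ℚ_[2])⁻¹, by rw [map_inv₀, inv_eq_iff_eq_inv]; exact hz⟩
    refine ⟨?_, ?_⟩
    · obtain ⟨a, ha⟩ := hunit _ hsum
      have hlt : ¬ OrdGE ord 2 (π + 2) := by
        intro hc
        have := h.ordGE_sub hc (.inr h21)
        rw [add_sub_cancel_right, OrdGE, or_iff_right hπ0] at this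
        lia
      have hge : OrdGE ord 1 (π + 2) := h.ordGE_add (.inr hπ1.ge) (.inr (by lia))
      rw [OrdGE, not_or] at hlt
      have := hge.resolve_left hlt.1
      refine ⟨a, ?_⟩
      rw [ha, heq]
      exact ⟨mul_ne_zero hπ0 hlt.1, by rw [h.mul _ _ hπ0 hlt.1]; lia⟩
    · rintro n ⟨a, ha, rfl⟩
      have h1 := hsub a (hnot a)
      have h2 := m.add_mem h1 h2m
      have := h.ordGE_mul ((hm' _).1 h1) ((hm' _).1 h2)
      have hfac : ((a : O) - 1) * ((a : O) - 1 + 2) = (a : O) ^ 2 - 1 := by ring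
      rw [← O.coe_mul, hfac] at this
      exact this.resolve_left ha
  · rintro ⟨rfl, hdim⟩
    have hsurj := (Algebra.finrank_eq_one_iff_bijective_algebraMap.1 hdim).2
    have hrange (x : F) : ∃ z : ℤ_[2], x = f z ∨ x = (f z)⁻¹ := by
      obtain ⟨y, rfl⟩ := hsurj x
      obtain ⟨z, rfl | rfl⟩ := Padic.exists_padicInt_eq_or_inv_eq y
      · exact ⟨z, .inl rfl⟩
      · exact ⟨z, .inr (map_inv₀ _ _)⟩
    have hne {z : ℤ_[2]} (hz : f z ≠ 0) : z ≠ 0 := (map_ne_zero_iff f hf).1 hz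
    have h21 : ord ((2 : ℕ) : F) = 1 := by
      have hnn := (h.ordGE_natCast 2).resolve_left hpF
      refine Int.eq_one_of_dvd_one hnn ?_
      obtain ⟨z, rfl | rfl⟩ := hrange π
      · rw [← hπ1, h.padicInt_eq hf (hne hπ0)]
        exact dvd_mul_left _ _
      · rw [ne_eq, inv_eq_zero] at hπ0
        rw [← hπ1, h.inv hπ0, h.padicInt_eq hf (hne hπ0), dvd_neg]
        exact dvd_mul_left _ _
    refine ⟨?_, ?_⟩
    · have hu : IsUnit ((3 : ℕ) : ℤ_[2]) := by
        rw [PadicInt.isUnit_iff, PadicInt.norm_natCast_eq_one_iff]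
        decide
      have h3 := h.padicInt_unit hf hu
      rw [map_natCast, Nat.cast_ofNat] at h3
      have h3m : (3 : O) ∉ m := fun hc => by
        have : 1 ≤ ord (3 : F) := (hm 3).1 hc
        lia
      obtain ⟨a, ha⟩ := hunit 3 h3m
      have h8 : ((a : O) : F) ^ 2 - 1 = ((2 : ℕ) : F) ^ 3 := by
        have : (3 : F) ^ 2 - 1 = ((2 : ℕ) : F) ^ 3 := by norm_num
        rw [ha]
        exact this
      refine ⟨a, ?_⟩
      rw [h8]
      exact ⟨pow_ne_zero _ hpF, by rw [h.pow hpF, h21]; norm_num⟩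
    · rintro n ⟨a, ha, rfl⟩
      obtain ⟨ha0, ha1⟩ := hord0 _ (hnot a)
      have hunit_of {z : ℤ_[2]} (hz0 : f z ≠ 0) (hz : ord (f z) = 0) : IsUnit z := by
        rw [h.padicInt_eq hf (hne hz0), h21, mul_one, Nat.cast_eq_zero] at hz
        rw [PadicInt.unitCoeff_spec (hne hz0), hz, pow_zero, mul_one]
        exact Units.isUnit _
      obtain ⟨z, hz, haz⟩ : ∃ z : ℤ_[2], IsUnit z ∧ ((a : O) : F) = f z := by
        obtain ⟨z, hz | hz⟩ := hrange (a : O)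
        · rw [hz] at ha0 ha1
          exact ⟨z, hunit_of ha0 ha1, hz⟩
        · rw [hz, ne_eq, inv_eq_zero] at ha0
          rw [hz, h.inv ha0, neg_eq_zero] at ha1
          obtain ⟨w, hw⟩ := (hunit_of ha0 ha1).exists_right_inv
          refine ⟨w, .of_mul_eq_one z (by rwa [mul_comm]), hz.trans (inv_eq_of_mul_eq_one_right ?_)⟩
          rw [← map_mul, hw, map_one]
      have h8 := (h.ordGE_padicInt_iff hf h21 _ 3).2
        (by exact_mod_cast PadicInt.eight_dvd_sq_sub_one hz)
      rw [map_sub, map_pow, map_one, ← haz] at h8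
      exact h8.resolve_left ha
end

section
/- Let p be a prime and F a finite extension of ℚ_p with ring of integers 𝒪 whose residue field has at least 4 elements. Then the group SL₂(𝒪) is perfect: its commutator subgroup equals the whole group SL₂(𝒪). -/
namespace Matrix.SpecialLinearGroup

open scoped commutatorElement

variable {R : Type*} [CommRing R]

/-- If `u` and `u ^ 2 - 1` are units, then every transvection in `SL₂(R)` is a commutator. -/
lemma transvection_mem_commutator_of_isUnit {u : R} (hu : IsUnit u) (hu2 : IsUnit (u ^ 2 - 1))
    {i j : Fin 2} (h : i ≠ j) (c : R) :
    transvection h c ∈ commutator (SpecialLinearGroup (Fin 2) R) := by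
  obtain ⟨v, hv⟩ := hu.exists_right_inv
  obtain ⟨w, hw⟩ := hu2.exists_right_inv
  have key (d e : SpecialLinearGroup (Fin 2) R) (he : d * e = transvection h c * e * d) :
      transvection h c ∈ commutator (SpecialLinearGroup (Fin 2) R) := by
    have hcomm : ⁅d, e⁆ = transvection h c := by
      rw [commutatorElement_def, mul_inv_eq_iff_eq_mul, mul_inv_eq_iff_eq_mul, he]
    rw [← hcomm]
    exact Subgroup.commutator_mem_commutator (Subgroup.mem_top _) (Subgroup.mem_top _)
  obtain ⟨rfl, rfl⟩ | ⟨rfl, rfl⟩ : (i = 0 ∧ j = 1) ∨ (i = 1 ∧ j = 0) := by omega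
  · obtain ⟨d, hd⟩ : ∃ d : SpecialLinearGroup (Fin 2) R, (d : Matrix _ _ R) = !![u, 0; 0, v] :=
      ⟨⟨!![u, 0; 0, v], by simp [hv]⟩, rfl⟩
    refine key d (transvection h (w * c)) ?_
    ext k l
    fin_cases k <;> fin_cases l <;>
      simp [hd, transvection_coe, Matrix.mul_apply, Fin.sum_univ_two, Matrix.single_apply]
    linear_combination (c * v) * hw - (u * w * c) * hv
  · obtain ⟨d, hd⟩ : ∃ d : SpecialLinearGroup (Fin 2) R, (d : Matrix _ _ R) = !![v, 0; 0, u] :=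
      ⟨⟨!![v, 0; 0, u], by simp [mul_comm v, hv]⟩, rfl⟩
    refine key d (transvection h (w * c)) ?_
    ext k l
    fin_cases k <;> fin_cases l <;>
      simp [hd, transvection_coe, Matrix.mul_apply, Fin.sum_univ_two, Matrix.single_apply]
    linear_combination (c * v) * hw - (u * w * c) * hv

/-- A matrix in `SL₂(R)` whose lower left entry is a unit is a product of transvections. -/
lemma eq_transvection_mul_of_isUnit (A : SpecialLinearGroup (Fin 2) R) {v : R}
    (hv : A 1 0 * v = 1) :
    A = transvection zero_ne_one ((A 0 0 - 1) * v) * transvection one_ne_zero (A 1 0) *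
      transvection zero_ne_one ((A 1 1 - 1) * v) := by
  have hdet := A.det_coe
  rw [Matrix.det_fin_two] at hdet
  ext k l
  fin_cases k <;> fin_cases l <;>
    simp [transvection_coe, Matrix.mul_apply, Fin.sum_univ_two, Matrix.single_apply]
  · linear_combination (1 - A 0 0) * hv
  · linear_combination (-(A 0 0 - 1) * (A 1 1 - 1) * v - A 0 1) * hv - v * hdet
  · linear_combination (1 - A 1 1) * hv

/-- Over a local ring, `SL₂` is generated by transvections. -/
lemma mem_of_transvection_mem [IsLocalRing R] (H : Subgroup (SpecialLinearGroup (Fin 2) R))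
    (hH : ∀ (i j : Fin 2) (h : i ≠ j) (c : R), transvection h c ∈ H)
    (A : SpecialLinearGroup (Fin 2) R) : A ∈ H := by
  have of_isUnit (B : SpecialLinearGroup (Fin 2) R) (hB : IsUnit (B 1 0)) : B ∈ H := by
    obtain ⟨v, hv⟩ := hB.exists_right_inv
    rw [eq_transvection_mul_of_isUnit B hv]
    exact mul_mem (mul_mem (hH _ _ _ _) (hH _ _ _ _)) (hH _ _ _ _)
  by_cases hc : IsUnit (A 1 0)
  · exact of_isUnit A hc
  · have hdet := A.det_coe
    rw [Matrix.det_fin_two] at hdet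
    have ha : IsUnit (A 0 0) := by
      have hbc : ¬ IsUnit (-(A 0 1 * A 1 0)) := fun h ↦
        hc (isUnit_of_mul_isUnit_right ((IsUnit.neg_iff _).1 h))
      refine isUnit_of_mul_isUnit_left
        ((IsLocalRing.isUnit_or_isUnit_of_add_one (a := A 0 0 * A 1 1)
          (b := -(A 0 1 * A 1 0)) ?_).resolve_right hbc)
      linear_combination hdet
    refine (Subgroup.mul_mem_cancel_left H (hH 1 0 one_ne_zero 1)).1 (of_isUnit _ ?_)
    have hval : (transvection one_ne_zero 1 * A : SpecialLinearGroup (Fin 2) R) 1 0 =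
        A 0 0 + A 1 0 := by
      simp [transvection_coe, Matrix.mul_apply, Fin.sum_univ_two, Matrix.single_apply]
    rw [hval]
    by_contra hn
    refine IsLocalRing.nonunits_add hn (b := -A 1 0) (fun h ↦ hc ?_) (by simpa using ha)
    simpa using h

/-- Over a local ring having a unit `u` with `u ^ 2 - 1` a unit, `SL₂` is perfect. -/
theorem commutator_eq_top_of_isLocalRing [IsLocalRing R] {u : R} (hu : IsUnit u)
    (hu2 : IsUnit (u ^ 2 - 1)) : commutator (SpecialLinearGroup (Fin 2) R) = ⊤ :=
  (Subgroup.eq_top_iff' _).2 <| mem_of_transvection_mem _ fun _ _ h c ↦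
    transvection_mem_commutator_of_isUnit hu hu2 h c

end Matrix.SpecialLinearGroup

/-- In a quotient with at least four elements, some class avoids `0`, `1` and `-1`. -/
lemma Ideal.exists_notMem_of_four_le_card_quotient {R : Type*} [CommRing R] {I : Ideal R}
    (h : 4 ≤ Nat.card (R ⧸ I)) : ∃ u : R, u ∉ I ∧ u - 1 ∉ I ∧ u + 1 ∉ I := by
  have : Finite (R ⧸ I) := Nat.finite_of_card_ne_zero (by omega)
  classical
  have hlt : (({0, 1, -1} : Finset (R ⧸ I)) : Set (R ⧸ I)).ncard < Nat.card (R ⧸ I) := by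
    rw [Set.ncard_coe_finset]
    exact Finset.card_le_three.trans_lt (by omega)
  obtain ⟨x, hx⟩ : ∃ x : R ⧸ I, x ∉ ({0, 1, -1} : Finset (R ⧸ I)) := by
    by_contra! hall
    rw [show (({0, 1, -1} : Finset (R ⧸ I)) : Set (R ⧸ I)) = Set.univ from
      Set.eq_univ_of_forall fun x ↦ Finset.mem_coe.2 (hall x), Set.ncard_univ] at hlt
    exact hlt.false
  obtain ⟨u, rfl⟩ := Ideal.Quotient.mk_surjective x
  simp only [Finset.mem_insert, Finset.mem_singleton, not_or] at hx
  simp_rw [← Ideal.Quotient.eq_zero_iff_mem, map_sub, map_add, map_one]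
  exact ⟨u, hx.1, fun h ↦ hx.2.1 (sub_eq_zero.1 h), fun h ↦ hx.2.2 (eq_neg_of_add_eq_zero_left h)⟩


/-- Let `p` be a prime and `F` a finite extension of `ℚ_p` whose
ring of integers `O` (the valuation ring of the normalized valuation `ord`) has
residue field `O/m` of cardinality `q ≥ 4`.  Then `SL₂(O)` is perfect: its
commutator subgroup is the whole group. -/
theorem stmt2 (p : ℕ) [Fact p.Prime] (F : Type*) [Field F]
    [Algebra ℚ_[p] F] [FiniteDimensional ℚ_[p] F]
    (ord : F → ℤ)
    (hord_mul : ∀ x y : F, x ≠ 0 → y ≠ 0 → ord (x * y) = ord x + ord y)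
    (hord_add : ∀ x y : F, x ≠ 0 → y ≠ 0 → x + y ≠ 0 →
      min (ord x) (ord y) ≤ ord (x + y))
    (hord_unif : ∃ π : F, π ≠ 0 ∧ ord π = 1)
    (O : Subring F)
    (hO : ∀ x : F, x ∈ O ↔ x = 0 ∨ 0 ≤ ord x)
    (m : Ideal O)
    (hm : ∀ x : O, x ∈ m ↔ 1 ≤ ord (x : F))
    (q : ℕ) (hq : q = Nat.card (O ⧸ m)) (hq4 : 4 ≤ q) :
    commutator (Matrix.SpecialLinearGroup (Fin 2) O) = ⊤ := by
  have ord_one : ord 1 = 0 := by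
    have h := hord_mul 1 1 one_ne_zero one_ne_zero
    rw [mul_one] at h
    omega
  have isUnit_of_notMem (x : O) (hx : x ∉ m) : IsUnit x := by
    have hx0 : (x : F) ≠ 0 := fun h ↦ hx (by
      rw [show x = 0 from Subtype.ext h]
      exact m.zero_mem)
    have hnonneg := ((hO x).1 x.2).resolve_left hx0
    rw [hm] at hx
    have hinv := hord_mul x (x : F)⁻¹ hx0 (inv_ne_zero hx0)
    rw [mul_inv_cancel₀ hx0, ord_one] at hinv
    exact IsUnit.of_mul_eq_one (⟨(x : F)⁻¹, (hO _).2 (.inr (by omega))⟩ : O)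
      (Subtype.ext (mul_inv_cancel₀ hx0))
  have one_notMem : (1 : O) ∉ m := by simp [hm, ord_one]
  have : IsLocalRing O := .of_isUnit_or_isUnit_one_sub_self fun a ↦ by
    by_contra! h
    have := m.add_mem (not_imp_comm.1 (isUnit_of_notMem a) h.1)
      (not_imp_comm.1 (isUnit_of_notMem (1 - a)) h.2)
    exact one_notMem (by simpa using this)
  obtain ⟨u, h0, h1, h2⟩ := Ideal.exists_notMem_of_four_le_card_quotient (hq ▸ hq4)
  refine Matrix.SpecialLinearGroup.commutator_eq_top_of_isLocalRing (isUnit_of_notMem u h0) ?_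
  rw [show u ^ 2 - 1 = (u - 1) * (u + 1) by ring]
  exact (isUnit_of_notMem _ h1).mul (isUnit_of_notMem _ h2)
end

section
/- For all g₁, g₂ ∈ SL₂(ℝ) and all z in the upper half-plane ℍ, one has J(g₁, g₂·z) · J(g₂, z) = c_ℝ(g₁, g₂) · J(g₁g₂, z), where g₂·z denotes the Möbius action of g₂ on z. -/
open scoped MatrixGroups UpperHalfPlane

open Complex

/-- The automorphy factor `J(g, z)` of half-integral weight: for
`g = (a b; c d) ∈ SL₂(ℝ)`, `J(g, z) = √d` if `c = 0, d > 0`; `J(g, z) = -√d` if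
`c = 0, d < 0`; and `J(g, z) = (cz + d)^(1/2)` if `c ≠ 0`, where the square root
is the principal branch (argument in `(-π, π]`). -/
noncomputable def Jfactor (g : SL(2, ℝ)) (z : ℍ) : ℂ :=
  if (g : Matrix (Fin 2) (Fin 2) ℝ) 1 0 = 0 then
    (if 0 < (g : Matrix (Fin 2) (Fin 2) ℝ) 1 1 then
        (((g : Matrix (Fin 2) (Fin 2) ℝ) 1 1 : ℂ)) ^ (1 / 2 : ℂ)
      else -((((g : Matrix (Fin 2) (Fin 2) ℝ) 1 1 : ℂ)) ^ (1 / 2 : ℂ)))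
  else (((g : Matrix (Fin 2) (Fin 2) ℝ) 1 0 : ℂ) * (z : ℂ)
      + ((g : Matrix (Fin 2) (Fin 2) ℝ) 1 1 : ℂ)) ^ (1 / 2 : ℂ)

/-- `x(g) = c` if `c ≠ 0`, and `x(g) = d` if `c = 0`, for `g = (a b; c d)`. -/
noncomputable def xEntry (g : SL(2, ℝ)) : ℝ :=
  if (g : Matrix (Fin 2) (Fin 2) ℝ) 1 0 ≠ 0 then (g : Matrix (Fin 2) (Fin 2) ℝ) 1 0
  else (g : Matrix (Fin 2) (Fin 2) ℝ) 1 1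

/-- The real quadratic Hilbert symbol `⟨a, b⟩_ℝ`, equal to `-1` if `a < 0` and
`b < 0`, and to `1` otherwise. -/
noncomputable def hilbertR (a b : ℝ) : ℝ := if a < 0 ∧ b < 0 then -1 else 1

/-- The Kubota 2-cocycle on `SL₂(ℝ)`:
`c_ℝ(g, h) = ⟨x(g)·x(gh), x(h)·x(gh)⟩_ℝ`. -/
noncomputable def kubotaR (g h : SL(2, ℝ)) : ℝ :=
  hilbertR (xEntry g * xEntry (g * h)) (xEntry h * xEntry (g * h))

/-- The principal square root squares to its argument. -/
theorem cpow_half_sq (w : ℂ) : (w ^ (1 / 2 : ℂ)) ^ 2 = w := by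
  rw [one_div]
  exact_mod_cast Complex.cpow_nat_inv_pow w two_ne_zero

/-- The principal square root has nonnegative real part. -/
theorem cpow_half_re_nonneg (w : ℂ) : 0 ≤ (w ^ (1 / 2 : ℂ)).re := by
  have h := Complex.cpow_ofReal_re w (1 / 2)
  push_cast at h
  rw [h]
  refine mul_nonneg (Real.rpow_nonneg (norm_nonneg _) _) (Real.cos_nonneg_of_mem_Icc ⟨?_, ?_⟩)
  · linarith [Complex.neg_pi_lt_arg w]
  · linarith [Complex.arg_le_pi w]

/-- The principal square root of a negative real number lies on the positive imaginary axis. -/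
theorem cpow_half_im_pos_of_neg {d : ℝ} (hd : d < 0) : 0 < ((d : ℂ) ^ (1 / 2 : ℂ)).im := by
  have h := Complex.cpow_ofReal_im (d : ℂ) (1 / 2)
  push_cast at h
  rw [h, Complex.arg_ofReal_of_neg hd, mul_one_div, Real.sin_pi_div_two, mul_one]
  exact Real.rpow_pos_of_pos (norm_pos_iff.mpr (by exact_mod_cast hd.ne)) _

theorem Jfactor_sq (g : SL(2, ℝ)) (z : ℍ) : Jfactor g z ^ 2 = (g 1 0 : ℂ) * z + (g 1 1 : ℂ) := by
  unfold Jfactor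
  split_ifs with hc hd
  · rw [cpow_half_sq, hc]; simp
  · rw [neg_sq, cpow_half_sq, hc]; simp
  · exact cpow_half_sq _

theorem xEntry_ne_zero (g : SL(2, ℝ)) : xEntry g ≠ 0 := by
  unfold xEntry
  split_ifs with hc
  · exact hc
  · intro hd
    have := g.det_coe
    rw [Matrix.det_fin_two, hd, not_not.mp hc] at this
    simp at this

/-- `Jfactor g z` has argument in `[0, π / 2)` if `xEntry g` is positive, and in `[-π / 2, 0)` if it
is negative. -/
theorem Jfactor_quadrant (g : SL(2, ℝ)) (z : ℍ) :
    (0 < xEntry g ∧ 0 < (Jfactor g z).re ∧ 0 ≤ (Jfactor g z).im) ∨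
      (xEntry g < 0 ∧ 0 ≤ (Jfactor g z).re ∧ (Jfactor g z).im < 0) := by
  have hx := xEntry_ne_zero g
  have hsq := Jfactor_sq g z
  have hre := congrArg Complex.re hsq
  have him := congrArg Complex.im hsq
  have hz : 0 < (z : ℂ).im := z.im_pos
  simp only [sq, mul_re, mul_im, add_re, add_im, ofReal_re, ofReal_im, zero_mul, sub_zero,
    add_zero] at hre him
  by_cases hc : g 1 0 = 0
  · have hxd : xEntry g = g 1 1 := by simp [xEntry, hc]
    rw [hxd] at hx ⊢
    simp only [hc, zero_mul, zero_add] at hre him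
    rcases hx.lt_or_gt with hd | hd
    · have hJ : Jfactor g z = -((g 1 1 : ℂ) ^ (1 / 2 : ℂ)) := by simp [Jfactor, hc, hd.not_gt]
      have him_neg : (Jfactor g z).im < 0 := by
        rw [hJ, neg_im]
        linarith [cpow_half_im_pos_of_neg hd]
      have : (Jfactor g z).re * (Jfactor g z).im = 0 := by linarith
      exact .inr ⟨hd, ((mul_eq_zero.mp this).resolve_right him_neg.ne).ge, him_neg⟩
    · have hJ : Jfactor g z = (g 1 1 : ℂ) ^ (1 / 2 : ℂ) := by simp [Jfactor, hc, hd]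
      have hre_pos : 0 < (Jfactor g z).re := by
        have := cpow_half_re_nonneg (g 1 1 : ℂ)
        rw [← hJ] at this
        refine this.lt_of_ne' fun h0 => ?_
        rw [h0] at hre
        nlinarith [sq_nonneg (Jfactor g z).im]
      have : (Jfactor g z).re * (Jfactor g z).im = 0 := by linarith
      exact .inl ⟨hd, hre_pos, ((mul_eq_zero.mp this).resolve_left hre_pos.ne').ge⟩
  · have hxc : xEntry g = g 1 0 := by simp [xEntry, hc]
    rw [hxc] at hx ⊢
    have hre_nonneg : 0 ≤ (Jfactor g z).re := by
      simp only [Jfactor, hc, if_false]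
      exact cpow_half_re_nonneg _
    have hre_pos : 0 < (Jfactor g z).re := by
      refine hre_nonneg.lt_of_ne' fun h0 => mul_ne_zero hx hz.ne' ?_
      rw [h0] at him
      linarith
    rcases hx.lt_or_gt with h | h
    · refine .inr ⟨h, hre_nonneg, ?_⟩
      nlinarith [mul_neg_of_neg_of_pos h hz]
    · refine .inl ⟨h, hre_pos, ?_⟩
      nlinarith [mul_pos h hz]

theorem Jfactor_mul_sq (g₁ g₂ : SL(2, ℝ)) (z : ℍ) :
    (Jfactor g₁ (g₂ • z) * Jfactor g₂ z) ^ 2 = Jfactor (g₁ * g₂) z ^ 2 := by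
  have hne : (z : ℂ) * (g₂ 1 0 : ℂ) + (g₂ 1 1 : ℂ) ≠ 0 := by
    rw [mul_comm]
    simpa [UpperHalfPlane.denom] using UpperHalfPlane.denom_ne_zero (g₂ : GL (Fin 2) ℝ) z
  rw [mul_pow, Jfactor_sq, Jfactor_sq, Jfactor_sq, UpperHalfPlane.specialLinearGroup_apply]
  simp only [Matrix.SpecialLinearGroup.coe_mul, Matrix.mul_apply, Fin.sum_univ_two,
    Algebra.algebraMap_self, RingHom.id_apply]
  push_cast
  field_simp
  ring

/-- For all `g₁, g₂ ∈ SL₂(ℝ)` and all `z ∈ ℍ`,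
`J(g₁, g₂·z) · J(g₂, z) = c_ℝ(g₁, g₂) · J(g₁g₂, z)`, where `g₂·z` is the Möbius
action of `g₂` on `z`. -/
theorem stmt3 (g₁ g₂ : SL(2, ℝ)) (z : ℍ) :
    Jfactor g₁ (g₂ • z) * Jfactor g₂ z = (kubotaR g₁ g₂ : ℂ) * Jfactor (g₁ * g₂) z := by
  have hab := sq_eq_sq_iff_eq_or_eq_neg.mp (Jfactor_mul_sq g₁ g₂ z)
  have h₁ := Jfactor_quadrant g₁ (g₂ • z)
  have h₂ := Jfactor_quadrant g₂ z
  have h₁₂ := Jfactor_quadrant (g₁ * g₂) z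
  unfold kubotaR hilbertR
  generalize Jfactor g₁ (g₂ • z) = a at *
  generalize Jfactor g₂ z = b at *
  generalize Jfactor (g₁ * g₂) z = c at *
  generalize xEntry g₁ = x at *
  generalize xEntry g₂ = y at *
  generalize xEntry (g₁ * g₂) = t at *
  have ha_pos : 0 < a.re ^ 2 + a.im ^ 2 := by
    rcases h₁ with ⟨-, h, -⟩ | ⟨-, -, h⟩ <;> nlinarith [sq_nonneg a.re, sq_nonneg a.im]
  have hb_pos : 0 < b.re ^ 2 + b.im ^ 2 := by
    rcases h₂ with ⟨-, h, -⟩ | ⟨-, -, h⟩ <;> nlinarith [sq_nonneg b.re, sq_nonneg b.im]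
  have hare : a.re * (b.re ^ 2 + b.im ^ 2) = (a * b).re * b.re + (a * b).im * b.im := by
    simp only [mul_re, mul_im]; ring
  have haim : a.im * (b.re ^ 2 + b.im ^ 2) = (a * b).im * b.re - (a * b).re * b.im := by
    simp only [mul_re, mul_im]; ring
  have hbre : b.re * (a.re ^ 2 + a.im ^ 2) = (a * b).re * a.re + (a * b).im * a.im := by
    simp only [mul_re, mul_im]; ring
  rcases h₁ with ⟨hx, ha, ha'⟩ | ⟨hx, ha, ha'⟩ <;>
  rcases h₂ with ⟨hy, hb, hb'⟩ | ⟨hy, hb, hb'⟩ <;>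
  rcases h₁₂ with ⟨ht, hc, hc'⟩ | ⟨ht, hc, hc'⟩ <;>
  simp only [mul_neg_iff, hx, hy, ht, hx.not_gt, hy.not_gt, ht.not_gt, and_true, and_false,
    or_true, or_false, if_true, if_false, ofReal_one, ofReal_neg, one_mul, neg_mul] <;>
  rcases hab with h | h <;>
  first
  | exact h
  | exfalso
    simp only [h, neg_re, neg_im] at hare haim hbre
    nlinarith
end

section
/- Let N be a positive square-free integer and L = ℚ(√−3). Then the following are equivalent: (a) N is the norm of an element of L^× (i.e. N = Norm_{L/ℚ}(x) for some x ∈ L^×); (b) N is the norm of an algebraic integer of L; (c) no prime factor of N is inert in L/ℚ, i.e. no prime p dividing N satisfies p ≡ 2 (mod 3); (d) there exist integers u and v with N = 3u² + v². -/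
theorem exists_eq_add_mul_sqrt_neg_three {L : Type*} [Field L] [Algebra ℚ L] {ι : L}
    (hι : ι ^ 2 = -3) (hadj : Algebra.adjoin ℚ {ι} = ⊤) (z : L) :
    ∃ a b : ℚ, z = algebraMap ℚ L a + algebraMap ℚ L b * ι := by
  have hz : z ∈ Algebra.adjoin ℚ {ι} := hadj ▸ Algebra.mem_top
  induction hz using Algebra.adjoin_induction with
  | mem w hw => exact ⟨0, 1, by simpa using hw⟩
  | algebraMap r => exact ⟨r, 0, by simp⟩
  | add w w' _ _ hw hw' =>
    obtain ⟨a, b, rfl⟩ := hw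
    obtain ⟨c, d, rfl⟩ := hw'
    exact ⟨a + c, b + d, by simp only [map_add]; ring⟩
  | mul w w' _ _ hw hw' =>
    obtain ⟨a, b, rfl⟩ := hw
    obtain ⟨c, d, rfl⟩ := hw'
    refine ⟨a * c - 3 * b * d, a * d + b * c, ?_⟩
    simp only [map_add, map_sub, map_mul, map_ofNat]
    linear_combination algebraMap ℚ L b * algebraMap ℚ L d * hι

open Module in
/-- The norm of `x + y√-3` over `ℚ` is `x² + 3y²`. -/
theorem norm_add_mul_sqrt_neg_three {L : Type*} [Field L] [Algebra ℚ L] {ι : L}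
    (hι : ι ^ 2 = -3) (hadj : Algebra.adjoin ℚ {ι} = ⊤) (x y : ℚ) :
    Algebra.norm ℚ (algebraMap ℚ L x + algebraMap ℚ L y * ι) = x ^ 2 + 3 * y ^ 2 := by
  have hli : LinearIndependent ℚ ![(1 : L), ι] := by
    rw [LinearIndependent.pair_iff]
    intro s t h
    simp only [Algebra.smul_def, mul_one] at h
    have h2 : algebraMap ℚ L (s ^ 2 + 3 * t ^ 2) = 0 := by
      simp only [map_add, map_mul, map_pow, map_ofNat]
      linear_combination (algebraMap ℚ L s - algebraMap ℚ L t * ι) * h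
        + (algebraMap ℚ L t) ^ 2 * hι
    rw [map_eq_zero_iff _ (algebraMap ℚ L).injective] at h2
    constructor <;> nlinarith [sq_nonneg s, sq_nonneg t]
  have hsp : ⊤ ≤ Submodule.span ℚ (Set.range ![(1 : L), ι]) := by
    intro z _
    obtain ⟨a, b, rfl⟩ := exists_eq_add_mul_sqrt_neg_three hι hadj z
    rw [Matrix.range_cons, Matrix.range_cons, Matrix.range_empty, Set.union_empty,
      Set.singleton_union, Submodule.mem_span_pair]
    exact ⟨a, b, by simp [Algebra.smul_def]⟩
  let B : Basis (Fin 2) ℚ L := Basis.mk hli hsp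
  have hB0 : B 0 = 1 := by simp [B]
  have hB1 : B 1 = ι := by simp [B]
  have key : ∀ a b : ℚ, algebraMap ℚ L a + algebraMap ℚ L b * ι = a • B 0 + b • B 1 := by
    intro a b
    rw [hB0, hB1, Algebra.smul_def, Algebra.smul_def, mul_one]
  have h0 : (algebraMap ℚ L x + algebraMap ℚ L y * ι) * B 0 = x • B 0 + y • B 1 := by
    rw [← key, hB0, mul_one]
  have h1 : (algebraMap ℚ L x + algebraMap ℚ L y * ι) * B 1 = (-3 * y) • B 0 + x • B 1 := by
    rw [← key, hB1]
    simp only [map_mul, map_neg, map_ofNat]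
    linear_combination (algebraMap ℚ L y) * hι
  rw [Algebra.norm_eq_matrix_det B, Matrix.det_fin_two]
  simp only [Algebra.leftMulMatrix_eq_repr_mul, h0, h1]
  simp
  ring

theorem Nat.Prime.dvd_of_dvd_sq_add_mul_add_sq {p : ℕ} (hp : p.Prime) (h3 : p % 3 = 2)
    {s t : ℤ} (h : (p : ℤ) ∣ s ^ 2 + s * t + t ^ 2) : (p : ℤ) ∣ t := by
  have := Fact.mk hp
  rw [← ZMod.intCast_zmod_eq_zero_iff_dvd] at h ⊢
  push_cast at h
  by_contra ht
  set g : ZMod p := s / t with hg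
  have hq : g ^ 2 + g + 1 = 0 := by
    rw [hg]
    field_simp
    linear_combination h
  have hg3 : g ^ 3 = 1 := by linear_combination (g - 1) * hq
  have hg1 : g ≠ 1 := by
    intro h1
    rw [h1] at hq
    have h30 : ((3 : ℕ) : ZMod p) = 0 := by push_cast; linear_combination hq
    rw [ZMod.natCast_eq_zero_iff, Nat.prime_dvd_prime_iff_eq hp Nat.prime_three] at h30
    omega
  have hg0 : g ≠ 0 := by
    intro h0
    simp [h0] at hg3
  have ho : orderOf g = 3 := orderOf_eq_prime hg3 hg1
  have hdvd := orderOf_dvd_of_pow_eq_one (ZMod.pow_card_sub_one_eq_one hg0)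
  rw [ho] at hdvd
  have := hp.two_le
  omega

/-- If `N * c ^ 2 = s ^ 2 + s * t + t ^ 2` with `N` square-free and `c ≠ 0`, then no prime factor
of `N` is congruent to `2` modulo `3`. -/
theorem not_inert_of_mul_sq_eq {N : ℕ} (hsq : Squarefree N) {p : ℕ} (hp : p.Prime)
    (hpN : p ∣ N) (c : ℕ) (hc : c ≠ 0) (s t : ℤ)
    (h : (N : ℤ) * c ^ 2 = s ^ 2 + s * t + t ^ 2) : p % 3 ≠ 2 := by
  intro h3
  induction c using Nat.strong_induction_on generalizing s t with
  | _ c ih =>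
    obtain ⟨m, rfl⟩ := hpN
    have hpd : (p : ℤ) ∣ s ^ 2 + s * t + t ^ 2 := ⟨m * c ^ 2, by rw [← h]; push_cast; ring⟩
    obtain ⟨t', rfl⟩ := hp.dvd_of_dvd_sq_add_mul_add_sq h3 hpd
    obtain ⟨s', rfl⟩ := hp.dvd_of_dvd_sq_add_mul_add_sq h3 (s := p * t') (t := s)
      (by convert hpd using 1; ring)
    have hp0 : (p : ℤ) ≠ 0 := by exact_mod_cast hp.ne_zero
    have h' : (m : ℤ) * c ^ 2 = p * (s' ^ 2 + s' * t' + t' ^ 2) := by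
      apply mul_left_cancel₀ hp0
      push_cast at h
      linear_combination h
    have hd : p ∣ m * c ^ 2 := by
      zify
      exact ⟨_, h'⟩
    have hm : ¬ p ∣ m := fun hm => hp.not_isUnit (hsq p (mul_dvd_mul_left p hm))
    obtain ⟨d, rfl⟩ := hp.dvd_of_dvd_pow ((hp.dvd_mul.1 hd).resolve_left hm)
    have hd0 : d ≠ 0 := right_ne_zero_of_mul hc
    refine ih d ?_ hd0 s' t' ?_
    · nlinarith [hp.two_le, Nat.pos_of_ne_zero hd0]
    · apply mul_left_cancel₀ hp0
      push_cast at h' ⊢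
      linear_combination h'

theorem ZMod.exists_sq_eq_neg_three {p : ℕ} (hp : p.Prime) (h3 : p % 3 = 1) :
    ∃ z : ZMod p, z ^ 2 = -3 := by
  have := Fact.mk hp
  have hd : 3 ∣ Nat.card (ZMod p)ˣ := by
    rw [Nat.card_eq_fintype_card, ZMod.card_units]
    omega
  obtain ⟨g, hg⟩ := exists_prime_orderOf_dvd_card' 3 hd
  have hg3 : (g : ZMod p) ^ 3 = 1 := by
    have := pow_orderOf_eq_one g
    rw [hg] at this
    rw [← Units.val_pow_eq_pow_val, this, Units.val_one]
  have hg1 : (g : ZMod p) - 1 ≠ 0 := by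
    intro h
    rw [sub_eq_zero, Units.val_eq_one] at h
    simp [h] at hg
  have hq : (g : ZMod p) ^ 2 + g + 1 = 0 := by
    apply mul_left_cancel₀ hg1
    linear_combination hg3
  exact ⟨2 * g + 1, by linear_combination 4 * hq⟩

/-- Thue's lemma. -/
theorem ZMod.exists_small_eq_mul {p : ℕ} (hp : p.Prime) (z : ZMod p) :
    ∃ a b : ℤ, (a ≠ 0 ∨ b ≠ 0) ∧ a ^ 2 < p ∧ b ^ 2 < p ∧ (a : ZMod p) = z * b := by
  have := Fact.mk hp
  set k := Nat.sqrt p with hk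
  have hkp : k ^ 2 < p := by
    refine lt_of_le_of_ne (Nat.sqrt_le' p) fun h => ?_
    have hp' := hp
    rw [← h] at hp'
    exact hp'.not_prime_pow le_rfl
  have hcard : (Finset.univ : Finset (ZMod p)).card <
      (Finset.range (k + 1) ×ˢ Finset.range (k + 1)).card := by
    rw [Finset.card_univ, ZMod.card, Finset.card_product, Finset.card_range]
    exact Nat.lt_succ_sqrt p
  obtain ⟨⟨a, b⟩, hab, ⟨c, d⟩, hcd, hne, h⟩ :=
    Finset.exists_ne_map_eq_of_card_lt_of_maps_to hcard
      (f := fun q : ℕ × ℕ => (q.1 : ZMod p) - z * q.2) (fun _ _ => Finset.mem_univ _)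
  simp only [Finset.mem_product, Finset.mem_range] at hab hcd
  have hsmall : ∀ x y : ℕ, x < k + 1 → y < k + 1 → ((x : ℤ) - y) ^ 2 < p := by
    intro x y hx hy
    have : ((x : ℤ) - y) ^ 2 ≤ (k : ℤ) ^ 2 := by
      apply sq_le_sq' <;> omega
    exact this.trans_lt (by exact_mod_cast hkp)
  refine ⟨a - c, b - d, ?_, hsmall _ _ hab.1 hcd.1, hsmall _ _ hab.2 hcd.2, ?_⟩
  · by_contra! h0
    apply hne
    ext <;> simp <;> omega
  · push_cast
    linear_combination h

theorem Nat.Prime.exists_eq_three_mul_sq_add_sq {p : ℕ} (hp : p.Prime) (h3 : p % 3 ≠ 2) :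
    ∃ u v : ℤ, (p : ℤ) = 3 * u ^ 2 + v ^ 2 := by
  rcases (by omega : p % 3 = 0 ∨ p % 3 = 1) with h | h
  · have : p = 3 :=
      ((Nat.prime_dvd_prime_iff_eq Nat.prime_three hp).1 (Nat.dvd_of_mod_eq_zero h)).symm
    exact ⟨1, 0, by simp [this]⟩
  obtain ⟨z, hz⟩ := ZMod.exists_sq_eq_neg_three hp h
  obtain ⟨a, b, hne, ha, hb, hab⟩ := ZMod.exists_small_eq_mul hp z
  have hd : (p : ℤ) ∣ a ^ 2 + 3 * b ^ 2 := by
    rw [← ZMod.intCast_zmod_eq_zero_iff_dvd]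
    push_cast
    rw [hab]
    linear_combination (b : ZMod p) ^ 2 * hz
  obtain ⟨k, hk⟩ := hd
  have hpos : 0 < a ^ 2 + 3 * b ^ 2 := by
    rcases hne with h0 | h0 <;> positivity
  have hp0 : (0 : ℤ) < p := by exact_mod_cast hp.pos
  have hk0 : 0 < k := by
    rw [hk] at hpos
    exact pos_of_mul_pos_right hpos hp0.le
  have hk4 : k < 4 := by nlinarith
  interval_cases k
  · exact ⟨b, a, by linear_combination -hk⟩
  · have hsqm : a ^ 2 % 3 = 0 ∨ a ^ 2 % 3 = 1 := by
      rcases (by omega : a % 3 = 0 ∨ a % 3 = 1 ∨ a % 3 = 2) with h | h | h <;>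
        simp [pow_two, Int.mul_emod, h]
    omega
  · have : (3 : ℤ) ∣ a := Int.prime_three.dvd_of_dvd_pow (n := 2)
      ⟨p - b ^ 2, by linear_combination hk⟩
    obtain ⟨a', rfl⟩ := this
    exact ⟨a', b, by linarith⟩

theorem exists_eq_three_mul_sq_add_sq {N : ℕ} (hN : N ≠ 0)
    (h : ∀ p : ℕ, p.Prime → p ∣ N → ¬ p % 3 = 2) :
    ∃ u v : ℤ, (N : ℤ) = 3 * u ^ 2 + v ^ 2 := by
  induction N using Nat.recOnMul with
  | zero => exact absurd rfl hN
  | one => exact ⟨0, 1, by simp⟩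
  | prime p hp => exact hp.exists_eq_three_mul_sq_add_sq (h p hp dvd_rfl)
  | mul a b iha ihb =>
    obtain ⟨u, v, ha⟩ := iha (left_ne_zero_of_mul hN) fun p hp hd => h p hp (hd.mul_right b)
    obtain ⟨x, y, hb⟩ := ihb (right_ne_zero_of_mul hN) fun p hp hd => h p hp (hd.mul_left a)
    exact ⟨u * y + v * x, v * y - 3 * u * x, by push_cast; rw [ha, hb]; ring⟩

theorem not_inert_of_eq_sq_add_three_mul_sq {N : ℕ} (hsq : Squarefree N) {x y : ℚ}
    (h : (N : ℚ) = x ^ 2 + 3 * y ^ 2) {p : ℕ} (hp : p.Prime) (hpN : p ∣ N) : p % 3 ≠ 2 := by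
  have hx : (x.den : ℚ) ≠ 0 := by exact_mod_cast x.den_nz
  have hy : (y.den : ℚ) ≠ 0 := by exact_mod_cast y.den_nz
  refine not_inert_of_mul_sq_eq hsq hp hpN (x.den * y.den) (mul_ne_zero x.den_nz y.den_nz)
    (x.num * y.den - y.num * x.den) (2 * y.num * x.den) ?_
  have h' : (N : ℚ) * (x.den * y.den) ^ 2
      = (x.num * y.den) ^ 2 + 3 * (y.num * x.den) ^ 2 := by
    rw [h, ← Rat.mul_den_eq_num x, ← Rat.mul_den_eq_num y]
    ring
  have h'' : (N : ℤ) * (x.den * y.den) ^ 2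
      = (x.num * y.den) ^ 2 + 3 * (y.num * x.den) ^ 2 := by exact_mod_cast h'
  push_cast
  linear_combination h''

/-- Let `N` be a positive square-free integer and `L = ℚ(√-3)`.
The following are equivalent:
(a) `N` is the norm of an element of `L^×`;
(b) `N` is the norm of an algebraic integer of `L`;
(c) no prime factor of `N` is inert in `L/ℚ`, i.e. no prime `p ∣ N` satisfies
`p ≡ 2 (mod 3)`;
(d) there are integers `u, v` with `N = 3u² + v²`. -/
theorem stmt10 (N : ℕ) (hN : 0 < N) (hsq : Squarefree N)
    (L : Type*) [Field L] [Algebra ℚ L] [FiniteDimensional ℚ L]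
    (ι : L) (hι : ι ^ 2 = -3) (hadj : Algebra.adjoin ℚ {ι} = ⊤) :
    List.TFAE
      [∃ x : L, x ≠ 0 ∧ Algebra.norm ℚ x = (N : ℚ),
       ∃ x : L, IsIntegral ℤ x ∧ Algebra.norm ℚ x = (N : ℚ),
       ∀ p : ℕ, p.Prime → p ∣ N → ¬ p % 3 = 2,
       ∃ u v : ℤ, (N : ℤ) = 3 * u ^ 2 + v ^ 2] := by
  tfae_have 2 → 1 := by
    rintro ⟨x, -, hx⟩
    refine ⟨x, ?_, hx⟩
    rintro rfl
    rw [Algebra.norm_zero] at hx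
    exact hN.ne (by exact_mod_cast hx)
  tfae_have 1 → 3 := by
    rintro ⟨z, -, hz⟩ p hp hpN
    obtain ⟨x, y, rfl⟩ := exists_eq_add_mul_sqrt_neg_three hι hadj z
    rw [norm_add_mul_sqrt_neg_three hι hadj] at hz
    exact not_inert_of_eq_sq_add_three_mul_sq hsq hz.symm hp hpN
  tfae_have 3 → 4 := exists_eq_three_mul_sq_add_sq hN.ne'
  tfae_have 4 → 2 := by
    rintro ⟨u, v, h⟩
    have hint : IsIntegral ℤ ι :=
      IsIntegral.of_pow two_pos (hι ▸ (by exact_mod_cast isIntegral_algebraMap (x := (-3 : ℤ))))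
    refine ⟨algebraMap ℚ L v + algebraMap ℚ L u * ι, ?_, ?_⟩
    · simp only [map_intCast]
      exact (isIntegral_algebraMap (x := v)).add ((isIntegral_algebraMap (x := u)).mul hint)
    · rw [norm_add_mul_sqrt_neg_three hι hadj]
      have h' : (N : ℚ) = 3 * (u : ℚ) ^ 2 + (v : ℚ) ^ 2 := by exact_mod_cast h
      rw [h', add_comm]
  tfae_finish
end

section
/- Let D > 1 be a square-free integer with D ≡ 1 (mod 8), F = ℚ(√D), 𝒪 the ring of integers of F, and 𝔡 the different ideal of F/ℚ. Then the following are equivalent: (i) there exist a prime ideal 𝔭 of 𝒪 of absolute norm 3, a totally positive σ ∈ F^×, and a fractional ideal 𝔞 of F with (σ)·𝔡·𝔭 = 𝔞² (equality of fractional ideals, (σ) being the principal fractional ideal generated by σ); (ii) there exist positive integers u and v with D = 3u² + v². -/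
open scoped NumberField nonZeroDivisors

/-- Descent step for the form `x² + xy + y²`. -/
theorem exists_eisenstein_of_mul_sq (n : ℤ) (p : ℕ) (hp : 0 < p) (x y : ℤ)
    (h : n * (p : ℤ) ^ 2 = x ^ 2 + x * y + y ^ 2) :
    ∃ a b : ℤ, n = a ^ 2 + a * b + b ^ 2 := by
  induction p using Nat.strong_induction_on generalizing x y with
  | _ p ih =>
    have round (z : ℤ) : ∃ q : ℤ, (2 * (z - p * q)) ^ 2 ≤ (p : ℤ) ^ 2 := by
      have hp' : (0 : ℤ) < 2 * p := by positivity
      have h1 := Int.mul_ediv_add_emod (2 * z + p) (2 * p)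
      have h2 := Int.emod_nonneg (2 * z + p) hp'.ne'
      have h3 := Int.emod_lt_of_pos (2 * z + p) hp'
      refine ⟨(2 * z + p) / (2 * p), ?_⟩
      apply sq_le_sq' <;> linarith
    obtain ⟨X, hX⟩ := round x
    obtain ⟨Y, hY⟩ := round y
    set q : ℤ := n * p - (2 * x * X + x * Y + y * X + 2 * y * Y) +
      p * (X ^ 2 + X * Y + Y ^ 2) with hq
    have hp0 : (0 : ℤ) < p := by exact_mod_cast hp
    have hpq : p * q = (x - p * X) ^ 2 + (x - p * X) * (y - p * Y) + (y - p * Y) ^ 2 := by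
      rw [hq]; linear_combination h
    have hq0 : 0 ≤ q := by
      have : 0 ≤ p * q := by
        rw [hpq]
        nlinarith [sq_nonneg (x - p * X + (y - p * Y)), sq_nonneg (x - p * X),
          sq_nonneg (y - p * Y)]
      exact nonneg_of_mul_nonneg_right this hp0
    have hqp : q < p := by
      have : (p : ℤ) * q < p * p := by
        rw [hpq]
        nlinarith [sq_nonneg (x - p * X - (y - p * Y)), mul_pos hp0 hp0]
      exact lt_of_mul_lt_mul_left this hp0.le
    rcases hq0.eq_or_lt with hq0 | hq0
    · rw [← hq0, mul_zero] at hpq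
      have hr : x - p * X = 0 := by
        nlinarith [sq_nonneg (x - p * X + 2 * (y - p * Y)), sq_nonneg (x - p * X)]
      have hs : y - p * Y = 0 := by
        nlinarith [sq_nonneg (2 * (x - p * X) + (y - p * Y)), sq_nonneg (y - p * Y)]
      refine ⟨X, Y, mul_right_cancel₀ (pow_ne_zero 2 hp0.ne') (h.trans ?_)⟩
      rw [sub_eq_zero.mp hr, sub_eq_zero.mp hs]
      ring
    · lift q to ℕ using hq0.le with q'
      set A := X ^ 2 + X * Y + Y ^ 2 - n with hA
      set B := 2 * n * p - (2 * x * X + x * Y + y * X + 2 * y * Y) with hB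
      refine ih q' (by exact_mod_cast hqp) (by exact_mod_cast hq0)
        (A * x + B * X) (A * y + B * Y) ?_
      rw [hq, hA, hB]
      linear_combination (X ^ 2 + X * Y + Y ^ 2 - n) ^ 2 * h

theorem exists_sq_add_three_mul_sq_of_eisenstein (x y : ℤ) :
    ∃ u v : ℤ, x ^ 2 + x * y + y ^ 2 = 3 * u ^ 2 + v ^ 2 := by
  rcases Int.even_or_odd' x with ⟨k, rfl | rfl⟩
  · exact ⟨k, y + k, by ring⟩
  rcases Int.even_or_odd' y with ⟨l, rfl | rfl⟩
  · exact ⟨l, 2 * k + 1 + l, by ring⟩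
  · exact ⟨k + l + 1, k - l, by ring⟩

theorem exists_int_sq_add_three_mul_sq_of_rat (n : ℤ) (s x y : ℚ) (hs : s ≠ 0)
    (h : n * s ^ 2 = 3 * x ^ 2 + y ^ 2) : ∃ u v : ℤ, n = 3 * u ^ 2 + v ^ 2 := by
  obtain ⟨X, hX⟩ : ∃ X, X = x / s := ⟨_, rfl⟩
  obtain ⟨Y, hY⟩ : ∃ Y, Y = y / s := ⟨_, rfl⟩
  have hXY : (n : ℚ) = 3 * X ^ 2 + Y ^ 2 := by
    rw [hX, hY]; field_simp; exact h
  have hXd : (X.den : ℚ) ≠ 0 := by exact_mod_cast X.den_ne_zero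
  have hYd : (Y.den : ℚ) ≠ 0 := by exact_mod_cast Y.den_ne_zero
  have hnum : (n : ℚ) * ((X.den * Y.den : ℕ) : ℚ) ^ 2 =
      3 * (X.num * Y.den) ^ 2 + (Y.num * X.den) ^ 2 := by
    rw [hXY, ← Rat.mul_den_eq_num X, ← Rat.mul_den_eq_num Y]
    push_cast
    ring
  have hint : n * ((X.den * Y.den : ℕ) : ℤ) ^ 2 =
      3 * (X.num * Y.den) ^ 2 + (Y.num * X.den) ^ 2 := by exact_mod_cast hnum
  obtain ⟨a, b, hab⟩ := exists_eisenstein_of_mul_sq n (X.den * Y.den)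
    (Nat.mul_pos X.den_pos Y.den_pos) (Y.num * X.den - X.num * Y.den) (2 * (X.num * Y.den))
    (by rw [hint]; ring)
  rw [hab]
  exact exists_sq_add_three_mul_sq_of_eisenstein a b

theorem not_isSquare_of_squarefree {D : ℤ} (hD1 : 1 < D) (hsq : Squarefree D) :
    ¬ IsSquare D := by
  rintro ⟨r, rfl⟩
  have := Int.isUnit_iff.mp (hsq r dvd_rfl)
  rcases this with rfl | rfl <;> norm_num at hD1

section QuadraticField

variable {F : Type*} [Field F] [NumberField F] {D : ℤ} {sd : F}

theorem exists_rat_coords (hsd : sd ^ 2 = (D : F)) (hadj : Algebra.adjoin ℚ {sd} = ⊤) (x : F) :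
    ∃ a b : ℚ, x = a + b * sd := by
  have hx : x ∈ Algebra.adjoin ℚ {sd} := hadj ▸ Algebra.mem_top
  induction hx using Algebra.adjoin_induction with
  | mem x hx => exact ⟨0, 1, by simpa using hx⟩
  | algebraMap r => exact ⟨r, 0, by simp⟩
  | add x y _ _ hx hy =>
    obtain ⟨a, b, rfl⟩ := hx
    obtain ⟨c, d, rfl⟩ := hy
    exact ⟨a + c, b + d, by push_cast; ring⟩
  | mul x y _ _ hx hy =>
    obtain ⟨a, b, rfl⟩ := hx
    obtain ⟨c, d, rfl⟩ := hy
    exact ⟨a * c + D * b * d, a * d + b * c, by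
      push_cast; linear_combination (b : F) * d * hsd⟩

theorem rat_coords_eq_zero (hD : ¬ IsSquare D) (hsd : sd ^ 2 = (D : F)) {a b : ℚ}
    (h : (a : F) + b * sd = 0) : a = 0 ∧ b = 0 := by
  have hb : b = 0 := by
    by_contra hb
    apply hD
    rw [← Rat.isSquare_intCast_iff]
    have h2 : (a : F) ^ 2 = b ^ 2 * D := by rw [← hsd]; linear_combination (a - b * sd) * h
    have h3 : a ^ 2 = b ^ 2 * D := by exact_mod_cast h2
    exact ⟨a / b, by field_simp; linarith⟩
  subst hb
  exact ⟨by simpa using h, rfl⟩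

theorem norm_rat_coords (hD : ¬ IsSquare D) (hsd : sd ^ 2 = (D : F))
    (hadj : Algebra.adjoin ℚ {sd} = ⊤) (a b : ℚ) :
    Algebra.norm ℚ ((a : F) + b * sd) = a ^ 2 - D * b ^ 2 := by
  let f : QuadraticAlgebra ℚ (D : ℚ) 0 →ₐ[ℚ] F :=
    QuadraticAlgebra.lift ⟨sd, by rw [← sq, hsd]; simp [Algebra.smul_def]⟩
  have hf (z) : f z = z.re + z.im * sd := by
    simp [f, QuadraticAlgebra.lift, Algebra.smul_def]
  have hbij : Function.Bijective f := by
    refine ⟨(injective_iff_map_eq_zero f).mpr fun z hz ↦ ?_, fun x ↦ ?_⟩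
    · rw [hf] at hz
      obtain ⟨h1, h2⟩ := rat_coords_eq_zero hD hsd hz
      exact QuadraticAlgebra.ext h1 h2
    · obtain ⟨a, b, rfl⟩ := exists_rat_coords hsd hadj x
      exact ⟨⟨a, b⟩, hf _⟩
  have h1 := Algebra.norm_eq_of_algEquiv (AlgEquiv.ofBijective f hbij) ⟨a, b⟩
  rw [AlgEquiv.ofBijective_apply, hf] at h1
  rw [h1, Algebra.norm_apply]
  refine (QuadraticAlgebra.det_toLinearMap_eq_norm _).trans ?_
  simp [QuadraticAlgebra.norm]
  ring

theorem exists_int_coords (hD : ¬ IsSquare D) (hsq : Squarefree D) (hD4 : D % 4 = 1)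
    (hsd : sd ^ 2 = (D : F))
    (hadj : Algebra.adjoin ℚ {sd} = ⊤) {x : F} (hx : IsIntegral ℤ x) :
    ∃ m k : ℤ, x = m + k * ((1 + sd) / 2) := by
  have key (y : F) (hy : IsIntegral ℤ y) : ∃ n : ℤ, (n : ℚ) = Algebra.norm ℚ y :=
    IsIntegrallyClosed.isIntegral_iff.mp (Algebra.isIntegral_norm ℚ hy)
  obtain ⟨a, b, rfl⟩ := exists_rat_coords hsd hadj x
  obtain ⟨n, hn⟩ := key _ hx
  obtain ⟨n', hn'⟩ := key _ (hx.add isIntegral_one)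
  rw [show (a : F) + b * sd + 1 = ((a + 1 : ℚ) : F) + b * sd by push_cast; ring,
    norm_rat_coords hD hsd hadj] at hn'
  rw [norm_rat_coords hD hsd hadj] at hn
  obtain ⟨t, ht⟩ : ∃ t : ℤ, (t : ℚ) = 2 * a := ⟨n' - n - 1, by push_cast; linarith⟩
  have hk : (D : ℚ) * (2 * b) ^ 2 = ((t ^ 2 - 4 * n : ℤ) : ℚ) := by
    push_cast; rw [ht, hn]; ring
  obtain ⟨k, hkb⟩ : ∃ k : ℤ, (k : ℚ) = 2 * b := by
    obtain ⟨c, hc⟩ : ∃ c, c = 2 * b := ⟨_, rfl⟩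
    rw [← hc] at hk ⊢
    have hcd : (c.den : ℚ) ≠ 0 := by exact_mod_cast c.den_ne_zero
    have h1 : D * c.num ^ 2 = (t ^ 2 - 4 * n) * (c.den : ℤ) ^ 2 := by
      have : (D : ℚ) * c.num ^ 2 = ((t ^ 2 - 4 * n : ℤ) : ℚ) * (c.den : ℚ) ^ 2 := by
        rw [← hk, ← Rat.mul_den_eq_num c]; ring
      exact_mod_cast this
    have hcop : IsCoprime ((c.den : ℤ) ^ 2) (c.num ^ 2) :=
      (Int.isCoprime_iff_gcd_eq_one.mpr
        (by simpa [Int.gcd, Nat.Coprime, Nat.gcd_comm] using c.reduced)).pow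
    have hdvd : (c.den : ℤ) * c.den ∣ D := by
      rw [← sq]; exact hcop.dvd_of_dvd_mul_right (h1 ▸ Dvd.intro_left _ rfl)
    have := Int.isUnit_iff.mp (hsq _ hdvd)
    have hden : c.den = 1 := by omega
    exact ⟨c.num, Rat.coe_int_num_of_den_eq_one hden⟩
  have hint : D * k ^ 2 = t ^ 2 - 4 * n := by
    rw [← hkb] at hk; exact_mod_cast hk
  have hpar : (t - k) % 2 = 0 := by
    have h1 : D * k ^ 2 % 4 = (t ^ 2 - 4 * n) % 4 := by rw [hint]
    rw [Int.mul_emod, hD4, Int.sub_emod, Int.mul_emod] at h1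
    rcases Int.even_or_odd' t with ⟨t', rfl | rfl⟩ <;>
    rcases Int.even_or_odd' k with ⟨k', rfl | rfl⟩ <;>
      ring_nf at h1 ⊢ <;> omega
  obtain ⟨m, hm⟩ := Int.dvd_of_emod_eq_zero hpar
  refine ⟨m, k, ?_⟩
  have ha : (a : F) = (t : F) / 2 := by
    rw [show a = t / 2 by linarith]; push_cast; rfl
  have hb : (b : F) = (k : F) / 2 := by
    rw [show b = k / 2 by linarith]; push_cast; rfl
  rw [ha, hb, show t = 2 * m + k by linarith]
  push_cast
  ring

open Polynomial in
theorem differentIdeal_eq_span_sqrt (hD : ¬ IsSquare D) (hsq : Squarefree D) (hD4 : D % 4 = 1)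
    (hadj : Algebra.adjoin ℚ {sd} = ⊤)
    (s : 𝓞 F) (hs : algebraMap (𝓞 F) F s = sd) (hsd : sd ^ 2 = (D : F)) :
    differentIdeal ℤ (𝓞 F) = Ideal.span {s} := by
  obtain ⟨e, rfl⟩ : ∃ e, D = 4 * e + 1 := ⟨D / 4, by omega⟩
  have hw0 : ((1 + sd) / 2) ^ 2 - (1 + sd) / 2 - (e : F) = 0 := by
    push_cast at hsd
    field_simp
    linear_combination hsd
  have hmonic : (X ^ 2 - X - C e : ℤ[X]).Monic := by monicity!
  have hdeg : (X ^ 2 - X - C e : ℤ[X]).natDegree = 2 := by compute_degree!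
  have hwint : IsIntegral ℤ ((1 + sd) / 2) := ⟨X ^ 2 - X - C e, hmonic, by
    rw [eval₂_sub, eval₂_sub, eval₂_X_pow, eval₂_X, eval₂_C]; exact hw0⟩
  obtain ⟨w, hw⟩ : ∃ w : 𝓞 F, algebraMap (𝓞 F) F w = (1 + sd) / 2 := ⟨⟨_, hwint⟩, rfl⟩
  have hws : 2 * w - 1 = s := by
    ext
    simp only [map_sub, map_mul, map_one, map_ofNat, hw, hs]
    field_simp
    ring
  have hroot : aeval w (X ^ 2 - X - C e : ℤ[X]) = 0 := by
    ext; simpa [hw] using hw0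
  have hwi : IsIntegral ℤ w := Algebra.IsIntegral.isIntegral w
  have hmin : minpoly ℤ w = X ^ 2 - X - C e := by
    refine (eq_of_monic_of_dvd_of_natDegree_le (minpoly.monic hwi) hmonic
      (minpoly.isIntegrallyClosed_dvd hwi hroot) ?_).symm
    rw [hdeg, minpoly.two_le_natDegree_iff hwi]
    rintro ⟨m, hm⟩
    have hm' : ((1 - 2 * m : ℚ) : F) + (1 : ℚ) * sd = 0 := by
      have : (m : F) = (1 + sd) / 2 := by
        rw [← hw, ← hm]; simp
      push_cast
      rw [this]; field_simp; ring
    exact one_ne_zero (rat_coords_eq_zero hD hsd hm').2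
  have hcond : conductor ℤ w = ⊤ := by
    rw [conductor_eq_top_iff_adjoin_eq_top, eq_top_iff]
    rintro x -
    obtain ⟨m, k, hmk⟩ := exists_int_coords hD hsq hD4 hsd hadj x.2
    have : x = algebraMap ℤ (𝓞 F) m + algebraMap ℤ (𝓞 F) k * w := by
      ext; exact hmk.trans (by simp [hw])
    rw [this]
    exact add_mem (algebraMap_mem _ _)
      (mul_mem (algebraMap_mem _ _) (Algebra.self_mem_adjoin_singleton ℤ w))
  have hadjw : Algebra.adjoin ℚ {algebraMap (𝓞 F) F w} = ⊤ := by
    rw [eq_top_iff, ← hadj]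
    apply Algebra.adjoin_le
    rw [Set.singleton_subset_iff]
    have : sd = 2 * algebraMap (𝓞 F) F w - 1 := by rw [hw]; field_simp; ring
    rw [this]
    exact sub_mem (mul_mem (ofNat_mem _ 2) (Algebra.self_mem_adjoin_singleton ℚ _))
      (one_mem _)
  have := conductor_mul_differentIdeal ℤ ℚ F w hadjw
  rw [hcond, ← Ideal.one_eq_top, one_mul, hmin] at this
  rw [this, ← hws]
  have h2' : aeval w (2 : ℤ[X]) = 2 := map_ofNat _ _
  simp [h2']

theorem norm_pos_of_totally_positive (hD : 0 ≤ D) (hsd : sd ^ 2 = (D : F))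
    (hadj : Algebra.adjoin ℚ {sd} = ⊤) {σ : F} (hσ : ∀ φ : F →+* ℝ, 0 < φ σ) :
    0 < Algebra.norm ℚ σ := by
  have key (ψ : F →ₐ[ℚ] ℂ) : ∃ r : ℝ, 0 < r ∧ ψ σ = r := by
    have hreal : NumberField.ComplexEmbedding.IsReal (ψ : F →+* ℂ) := by
      obtain ⟨t, ht⟩ : ∃ t : ℝ, ψ sd = t := by
        have h1 : (ψ sd) ^ 2 = ((√(D : ℝ) : ℝ) : ℂ) ^ 2 := by
          rw [← map_pow, hsd, map_intCast, ← Complex.ofReal_pow,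
            Real.sq_sqrt (by exact_mod_cast hD)]
          simp
        rcases sq_eq_sq_iff_eq_or_eq_neg.mp h1 with h | h
        · exact ⟨_, h⟩
        · exact ⟨-√(D : ℝ), by rw [h]; simp⟩
      refine RingHom.ext fun x ↦ ?_
      obtain ⟨a, b, rfl⟩ := exists_rat_coords hsd hadj x
      simp [NumberField.ComplexEmbedding.conjugate_coe_eq, ht]
    exact ⟨hreal.embedding σ, hσ _, (hreal.coe_embedding_apply σ).symm⟩
  choose r hr0 hr using key
  have h := Algebra.norm_eq_prod_embeddings ℚ ℂ σ
  simp only [hr] at h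
  have h' : ((Algebra.norm ℚ σ : ℚ) : ℝ) = ∏ ψ, r ψ := by
    apply Complex.ofReal_injective
    simpa using h
  have : (0 : ℝ) < (Algebra.norm ℚ σ : ℚ) := h' ▸ Finset.prod_pos fun ψ _ ↦ hr0 ψ
  exact_mod_cast this

theorem exists_sq_add_three_mul_sq_of_isSquare_ideal (hD1 : 1 < D) (hsq : Squarefree D)
    (hD8 : D % 8 = 1) (hsd : sd ^ 2 = (D : F)) (hadj : Algebra.adjoin ℚ {sd} = ⊤)
    (s : 𝓞 F) (hs : algebraMap (𝓞 F) F s = sd) {P : Ideal (𝓞 F)} (hP : Ideal.absNorm P = 3)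
    {σ : F} (hσ : ∀ φ : F →+* ℝ, 0 < φ σ) {a : FractionalIdeal (𝓞 F)⁰ F}
    (h : FractionalIdeal.spanSingleton (𝓞 F)⁰ σ
              * (differentIdeal ℤ (𝓞 F) : FractionalIdeal (𝓞 F)⁰ F)
              * (P : FractionalIdeal (𝓞 F)⁰ F)
            = a ^ 2) :
    ∃ u v : ℤ, 0 < u ∧ 0 < v ∧ D = 3 * u ^ 2 + v ^ 2 := by
  have hD := not_isSquare_of_squarefree hD1 hsq
  have hN := norm_pos_of_totally_positive (by omega) hsd hadj hσ
  have hNsd : Algebra.norm ℚ sd = -D := by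
    have := norm_rat_coords hD hsd hadj 0 1
    simpa using this
  have hD0 : (0 : ℚ) < D := by exact_mod_cast (by omega : 0 < D)
  rw [differentIdeal_eq_span_sqrt hD hsq (by omega) hadj s hs hsd,
    FractionalIdeal.coeIdeal_span_singleton, hs] at h
  replace h := congrArg FractionalIdeal.absNorm h
  rw [map_mul, map_mul, map_pow, FractionalIdeal.absNorm_span_singleton,
    FractionalIdeal.absNorm_span_singleton, FractionalIdeal.coeIdeal_absNorm, hP, hNsd,
    abs_of_pos hN, abs_neg, abs_of_pos hD0] at h
  obtain ⟨x, y, rfl⟩ := exists_rat_coords hsd hadj σ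
  rw [norm_rat_coords hD hsd hadj] at h hN
  have hx : x ≠ 0 := by
    rintro rfl
    nlinarith [mul_nonneg hD0.le (sq_nonneg y)]
  obtain ⟨u, v, huv⟩ := exists_int_sq_add_three_mul_sq_of_rat D (3 * x) (FractionalIdeal.absNorm a)
    (3 * D * y) (mul_ne_zero three_ne_zero hx) (by push_cast at h; linear_combination 3 * h)
  have hu : u ≠ 0 := by
    rintro rfl
    exact hD ⟨v, by rw [huv]; ring⟩
  have hv : v ≠ 0 := by
    rintro rfl
    rcases Int.even_or_odd' u with ⟨k, rfl | rfl⟩ <;> ring_nf at huv <;> omega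
  exact ⟨|u|, |v|, abs_pos.mpr hu, abs_pos.mpr hv, by rw [sq_abs, sq_abs, huv]⟩

end QuadraticField

/-- In a commutative ring, a root `β` of `X² - v X - 3w²` with `v`, `w` coprime generates
`(3, β) (β, w)²`. -/
theorem span_three_mul_span_sq {R : Type*} [CommRing R] {β v w : R}
    (hβ : β ^ 2 = v * β + 3 * w ^ 2) (hvw : IsCoprime v w) :
    Ideal.span {3, β} * Ideal.span {β, w} ^ 2 = Ideal.span {β} := by
  apply le_antisymm
  · rw [sq, Ideal.span_pair_mul_span_pair, Ideal.mul_le]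
    intro r hr t ht
    obtain ⟨c, d, rfl⟩ := Ideal.mem_span_pair.mp hr
    have ht' : t ∈ Ideal.span {β, w ^ 2} := by
      refine (Ideal.span_le.mpr ?_) ht
      rintro z (rfl | rfl | rfl | rfl)
      · exact Ideal.mul_mem_right _ _ (Ideal.subset_span (by simp))
      · exact Ideal.mul_mem_right _ _ (Ideal.subset_span (by simp))
      · exact Ideal.mul_mem_left _ _ (Ideal.subset_span (by simp))
      · exact Ideal.subset_span (by simp [sq])
    obtain ⟨e, f, rfl⟩ := Ideal.mem_span_pair.mp ht'
    refine Ideal.mem_span_singleton.mpr ⟨c * 3 * e + d * (e * β + f * w ^ 2) + c * f * (β - v), ?_⟩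
    linear_combination (-c * f) * hβ
  · rw [Ideal.span_singleton_le_iff_mem]
    have h3 : (3 : R) ∈ Ideal.span {3, β} := Ideal.subset_span (by simp)
    have hb : β ∈ Ideal.span {3, β} := Ideal.subset_span (by simp)
    have hb' : β ∈ Ideal.span {β, w} := Ideal.subset_span (by simp)
    have hw' : w ∈ Ideal.span {β, w} := Ideal.subset_span (by simp)
    rw [sq]
    have m1 := Ideal.mul_mem_mul hb (Ideal.mul_mem_mul hb' hb')
    have m2 := Ideal.mul_mem_mul hb (Ideal.mul_mem_mul hw' hw')
    have m3 := Ideal.mul_mem_mul h3 (Ideal.mul_mem_mul hw' hw')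
    obtain ⟨c, d, hcd⟩ := hvw.pow (m := 2) (n := 2)
    have : β = c * (β * (β * β)) + (d - 3 * c) * (β * (w * w)) - c * v * (3 * (w * w)) := by
      linear_combination (-β) * hcd - (c * v + c * β) * hβ
    have hmem := sub_mem (add_mem (Ideal.mul_mem_left _ c m1)
      (Ideal.mul_mem_left _ (d - 3 * c) m2)) (Ideal.mul_mem_left _ (c * v) m3)
    rwa [← this] at hmem

theorem Nat.eq_three_of_mul_sq_eq {p i w : ℕ} (hp : p ∣ 9) (hw : w ≠ 0)
    (h : p * i ^ 2 = 3 * w ^ 2) : p = 3 := by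
  have no_sq {x y : ℕ} (hx : x ^ 2 = 3 * y ^ 2) : y = 0 := by
    by_contra hy
    have : IsSquare (3 : ℚ) := ⟨x / y, by
      have hy' : (y : ℚ) ≠ 0 := by exact_mod_cast hy
      field_simp
      exact_mod_cast hx.symm⟩
    have h3 : IsSquare (3 : ℕ) := by
      rw [← Rat.isSquare_natCast_iff]; exact_mod_cast this
    exact Nat.prime_three.prime.not_isSquare h3
  have hp' : p ∈ Nat.divisors 9 := Nat.mem_divisors.mpr ⟨hp, by norm_num⟩
  rw [show Nat.divisors 9 = {1, 3, 9} from by decide] at hp'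
  simp only [Finset.mem_insert, Finset.mem_singleton] at hp'
  rcases hp' with rfl | rfl | rfl
  · exact absurd (no_sq (by linarith : i ^ 2 = 3 * w ^ 2)) hw
  · rfl
  · exact absurd (no_sq (by linarith : (3 * i) ^ 2 = 3 * w ^ 2)) hw

section QuadraticField

variable {F : Type*} [Field F] [NumberField F] {D : ℤ} {sd : F}

theorem exists_isSquare_ideal_of_sq_add_three_mul_sq (hD1 : 1 < D) (hsq : Squarefree D)
    (hD8 : D % 8 = 1) (hsd : sd ^ 2 = (D : F)) (hadj : Algebra.adjoin ℚ {sd} = ⊤)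
    (s : 𝓞 F) (hs : algebraMap (𝓞 F) F s = sd) {u v : ℤ} (hu : 0 < u)
    (huv : D = 3 * u ^ 2 + v ^ 2) :
    ∃ P : Ideal (𝓞 F), P.IsPrime ∧ Ideal.absNorm P = 3 ∧
      ∃ σ : F, σ ≠ 0 ∧ (∀ φ : F →+* ℝ, 0 < φ σ) ∧
        ∃ a : FractionalIdeal (𝓞 F)⁰ F, a ≠ 0 ∧
          FractionalIdeal.spanSingleton (𝓞 F)⁰ σ
              * (differentIdeal ℤ (𝓞 F) : FractionalIdeal (𝓞 F)⁰ F)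
              * (P : FractionalIdeal (𝓞 F)⁰ F)
            = a ^ 2 := by
  have hD := not_isSquare_of_squarefree hD1 hsq
  obtain ⟨w, rfl⟩ : ∃ w, u = 2 * w := by
    rcases Int.even_or_odd' u with ⟨k, rfl | rfl⟩
    · exact ⟨k, rfl⟩
    · rcases Int.even_or_odd' v with ⟨l, rfl | rfl⟩ <;> ring_nf at huv <;> omega
  have hw : w ≠ 0 := by omega
  have hvw : IsCoprime v w := by
    rw [Int.isCoprime_iff_gcd_eq_one]
    obtain ⟨x, hx⟩ := Int.gcd_dvd_left v w
    obtain ⟨y, hy⟩ := Int.gcd_dvd_right v w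
    have : (Int.gcd v w : ℤ) * Int.gcd v w ∣ D :=
      ⟨12 * y ^ 2 + x ^ 2, by
        linear_combination huv + (v + Int.gcd v w * x) * hx + 12 * (w + Int.gcd v w * y) * hy⟩
    have := Int.isUnit_iff.mp (hsq _ this)
    omega
  have hDF : sd ^ 2 = 12 * (w : F) ^ 2 + (v : F) ^ 2 := by rw [hsd, huv]; push_cast; ring
  have hβ0 : ((v + sd) / 2) ^ 2 = v * ((v + sd) / 2) + 3 * (w : F) ^ 2 := by
    field_simp; linear_combination hDF
  have hβint : IsIntegral ℤ ((v + sd) / 2) := by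
    refine ⟨Polynomial.X ^ 2 - Polynomial.C v * Polynomial.X - Polynomial.C (3 * w ^ 2),
      by monicity!, ?_⟩
    simp only [Polynomial.eval₂_sub, Polynomial.eval₂_mul, Polynomial.eval₂_X_pow,
      Polynomial.eval₂_X, Polynomial.eval₂_C]
    rw [hβ0, eq_intCast, eq_intCast]; push_cast; ring
  obtain ⟨β, hβF⟩ : ∃ β : 𝓞 F, algebraMap (𝓞 F) F β = (v + sd) / 2 := ⟨⟨_, hβint⟩, rfl⟩
  have hβ : β ^ 2 = v * β + 3 * (w : 𝓞 F) ^ 2 := by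
    ext
    simp only [map_pow, map_add, map_mul, map_intCast, map_ofNat, hβF]
    exact hβ0
  have hspan := span_three_mul_span_sq hβ (by simpa using hvw.map (Int.castRingHom (𝓞 F)))
  set P : Ideal (𝓞 F) := Ideal.span {3, β}
  set I : Ideal (𝓞 F) := Ideal.span {β, (w : 𝓞 F)}
  have hNβ : (Algebra.norm ℤ β).natAbs = 3 * w.natAbs ^ 2 := by
    have h1 : Algebra.norm ℤ β = -(3 * w ^ 2) := by
      have h2 : ((Algebra.norm ℤ β : ℤ) : ℚ) = -(3 * w ^ 2) := by
        have h3 := norm_rat_coords hD hsd hadj (v / 2) (1 / 2)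
        have h4 : algebraMap (𝓞 F) F β = ((v / 2 : ℚ) : F) + ((1 / 2 : ℚ) : F) * sd := by
          rw [hβF]; push_cast; ring
        refine (Algebra.coe_norm_int β).trans ((congrArg _ h4).trans ?_)
        rw [h3, huv]; push_cast; ring
      exact_mod_cast h2
    rw [h1, Int.natAbs_neg, Int.natAbs_mul, Int.natAbs_pow]; rfl
  have hP9 : Ideal.absNorm P ∣ 9 := by
    have h1 : Ideal.absNorm P ∣ Ideal.absNorm (Ideal.span {(3 : 𝓞 F)}) :=
      Ideal.absNorm_dvd_absNorm_of_le (Ideal.span_mono (by simp))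
    have h2 : Ideal.absNorm (Ideal.span {(3 : 𝓞 F)}) = 9 := by
      have h3 : Algebra.norm ℤ (3 : 𝓞 F) = 9 := by
        have h4 : ((Algebra.norm ℤ (3 : 𝓞 F) : ℤ) : ℚ) = 9 := by
          have h5 := norm_rat_coords hD hsd hadj 3 0
          have h6 : algebraMap (𝓞 F) F 3 = ((3 : ℚ) : F) + ((0 : ℚ) : F) * sd := by
            simp only [map_ofNat, Rat.cast_zero, zero_mul, add_zero, Rat.cast_ofNat]
          refine (Algebra.coe_norm_int (3 : 𝓞 F)).trans ((congrArg _ h6).trans ?_)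
          rw [h5]; norm_num
        exact_mod_cast h4
      rw [Ideal.absNorm_span_singleton, h3]; rfl
    rwa [h2] at h1
  have hP3 : Ideal.absNorm P = 3 := by
    refine Nat.eq_three_of_mul_sq_eq hP9 (Int.natAbs_ne_zero.mpr hw) ?_ (i := Ideal.absNorm I)
    rw [← map_pow, ← map_mul, hspan, Ideal.absNorm_span_singleton, hNβ]
  have hsd0 : sd ≠ 0 := by
    rintro rfl
    have : (D : F) = 0 := by rw [← hsd]; simp
    have : D = 0 := by exact_mod_cast this
    omega
  have hpos (φ : F →+* ℝ) : 0 < φ (sd * ((v + sd) / 2)) := by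
    have h1 : φ sd ^ 2 = D := by rw [← map_pow, hsd, map_intCast]
    have h2 : φ (sd * ((v + sd) / 2)) = (D + v * φ sd) / 2 := by
      simp only [map_mul, map_div₀, map_add, map_intCast, map_ofNat]
      linear_combination h1 / 2
    have hD0 : (1 : ℝ) < D := by exact_mod_cast hD1
    have h3 : (v : ℝ) ^ 2 < D := by
      have : v ^ 2 < D := by rw [huv]; nlinarith
      exact_mod_cast this
    have h4 : |v * φ sd| < D := by
      apply abs_lt_of_sq_lt_sq _ (by linarith)
      rw [mul_pow, h1]
      nlinarith
    rw [h2]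
    linarith [(abs_lt.mp h4).1]
  have hI0 : (I : FractionalIdeal (𝓞 F)⁰ F) ≠ 0 := by
    rw [FractionalIdeal.coeIdeal_ne_zero]
    intro h
    have : (w : 𝓞 F) ∈ I := Ideal.subset_span (by simp)
    rw [h, Ideal.mem_bot] at this
    exact hw (by exact_mod_cast this)
  have hP0 : (P : FractionalIdeal (𝓞 F)⁰ F) ≠ 0 := by
    rw [FractionalIdeal.coeIdeal_ne_zero]
    intro h
    rw [h] at hP3
    simp at hP3
  have hsp0 : FractionalIdeal.spanSingleton (𝓞 F)⁰ sd ≠ 0 :=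
    FractionalIdeal.spanSingleton_ne_zero_iff.mpr hsd0
  refine ⟨P, Ideal.isPrime_of_irreducible_absNorm (hP3 ▸ Nat.prime_three), hP3,
    sd * ((v + sd) / 2), ?_, hpos,
    FractionalIdeal.spanSingleton (𝓞 F)⁰ sd * P * I, mul_ne_zero (mul_ne_zero hsp0 hP0) hI0, ?_⟩
  · refine mul_ne_zero hsd0 fun h ↦ ?_
    rw [h] at hβ0
    have : (w : F) = 0 := by simpa using hβ0
    exact hw (by exact_mod_cast this)
  · have hspanF := congrArg (fun J : Ideal (𝓞 F) ↦ (J : FractionalIdeal (𝓞 F)⁰ F)) hspan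
    simp only [FractionalIdeal.coeIdeal_mul, FractionalIdeal.coeIdeal_pow,
      FractionalIdeal.coeIdeal_span_singleton, hβF] at hspanF
    rw [differentIdeal_eq_span_sqrt hD hsq (by omega) hadj s hs hsd,
      FractionalIdeal.coeIdeal_span_singleton, hs,
      ← FractionalIdeal.spanSingleton_mul_spanSingleton, ← hspanF]
    ring

end QuadraticField

/-- Let `D > 1` be square-free with `D ≡ 1 (mod 8)`, `F = ℚ(√D)`,
`𝒪` its ring of integers and `𝔡` the different of `F/ℚ`.  The following are
equivalent: (i) there exist a prime ideal `𝔭` of `𝒪` of absolute norm `3`, a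
totally positive `σ ∈ F^×` and a fractional ideal `𝔞` with `(σ)·𝔡·𝔭 = 𝔞²`;
(ii) there exist positive integers `u, v` with `D = 3u² + v²`. -/
theorem stmt11 (D : ℤ) (hD1 : 1 < D) (hsq : Squarefree D) (hD8 : D % 8 = 1)
    (F : Type*) [Field F] [NumberField F]
    (sd : F) (hsd : sd ^ 2 = (D : F)) (hadj : Algebra.adjoin ℚ {sd} = ⊤) :
    (∃ P : Ideal (𝓞 F), P.IsPrime ∧ Ideal.absNorm P = 3 ∧
      ∃ σ : F, σ ≠ 0 ∧ (∀ φ : F →+* ℝ, 0 < φ σ) ∧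
        ∃ a : FractionalIdeal (𝓞 F)⁰ F, a ≠ 0 ∧
          FractionalIdeal.spanSingleton (𝓞 F)⁰ σ
              * (differentIdeal ℤ (𝓞 F) : FractionalIdeal (𝓞 F)⁰ F)
              * (P : FractionalIdeal (𝓞 F)⁰ F)
            = a ^ 2)
    ↔ (∃ u v : ℤ, 0 < u ∧ 0 < v ∧ D = 3 * u ^ 2 + v ^ 2) := by
  have hsint : IsIntegral ℤ sd :=
    IsIntegral.of_pow two_pos (hsd ▸ isIntegral_algebraMap (R := ℤ) (x := D))
  obtain ⟨s, hs⟩ : ∃ s : 𝓞 F, algebraMap (𝓞 F) F s = sd := ⟨⟨sd, hsint⟩, rfl⟩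
  constructor
  · rintro ⟨P, -, hP, σ, -, hσ, a, -, h⟩
    exact exists_sq_add_three_mul_sq_of_isSquare_ideal hD1 hsq hD8 hsd hadj s hs hP hσ h
  · rintro ⟨u, v, hu, -, huv⟩
    exact exists_isSquare_ideal_of_sq_add_three_mul_sq hD1 hsq hD8 hsd hadj s hs hu huv
end
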